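/- For every n ≥ 1, U_{n,X} ⊆ W_{n,X}. -/

import Mathlib

variable (k : Type*) [Field k] [Fintype k] (X : Type*)

/-- `k⟨X⟩₀`: the free non-unital associative `k`-algebra on `X`, identified with
the augmentation submodule (elements with zero constant term) of the free
unital associative algebra `FreeAlgebra k X`. -/
noncomputable def AugF : Submodule k (FreeAlgebra k X) :=
  LinearMap.ker (FreeAlgebra.lift k (fun _ : X => (0 : k))).toLinearMap

/-- A `T`-space of `k⟨X⟩₀`: a `k`-linear subspace of `k⟨X⟩₀` invariant under all
substitutions `x ↦ g x` with each `g x ∈ k⟨X⟩₀` (equivalently, under all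
non-unital `k`-algebra endomorphisms of `k⟨X⟩₀`). -/
def IsTSpaceF (V : Submodule k (FreeAlgebra k X)) : Prop :=
  V ≤ AugF k X ∧
    ∀ g : X → FreeAlgebra k X, (∀ x, g x ∈ AugF k X) →
      ∀ v ∈ V, FreeAlgebra.lift k g v ∈ V

/-- `H^S`: the smallest `T`-space of `k⟨X⟩₀` containing `H`. -/
noncomputable def TSpF (H : Set (FreeAlgebra k X)) : Submodule k (FreeAlgebra k X) :=
  sInf {V | IsTSpaceF k X V ∧ H ⊆ V}

/-- A `T`-ideal of `k⟨X⟩₀`: a `T`-space that is also a (two-sided) ideal of `k⟨X⟩₀`. -/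
def IsTIdealF (V : Submodule k (FreeAlgebra k X)) : Prop :=
  IsTSpaceF k X V ∧ ∀ v ∈ V, ∀ a ∈ AugF k X, a * v ∈ V ∧ v * a ∈ V

/-- `H^T`: the smallest `T`-ideal of `k⟨X⟩₀` containing `H`. -/
noncomputable def TIdF (H : Set (FreeAlgebra k X)) : Submodule k (FreeAlgebra k X) :=
  sInf {V | IsTIdealF k X V ∧ H ⊆ V}

/-- `W_{n,X} = {x + x^{q^n}}^S + {x^{q^n+1}}^S` for a fixed generator `x ∈ X`. -/
noncomputable def WnF (x : X) (n : ℕ) : Submodule k (FreeAlgebra k X) :=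
  TSpF k X {FreeAlgebra.ι k x + FreeAlgebra.ι k x ^ (Fintype.card k ^ n)} ⊔
    TSpF k X {FreeAlgebra.ι k x ^ (Fintype.card k ^ n + 1)}

/-- `U_{n,X} = {x - x^{q^{2n}}}^T` for a fixed generator `x ∈ X`. -/
noncomputable def UnF (x : X) (n : ℕ) : Submodule k (FreeAlgebra k X) :=
  TIdF k X {FreeAlgebra.ι k x - FreeAlgebra.ι k x ^ (Fintype.card k ^ (2 * n))}

section PartB
variable {κ R : Type*} [Field κ] [Ring R] [Algebra κ R]

/-- The span of the values of `y + y^Q`, `y^(Q+1)` on an ideal `B`. -/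
def WW (κ : Type*) {R : Type*} [Field κ] [Ring R] [Algebra κ R] (B : Ideal R) (Q : ℕ) :
    Submodule κ R :=
  Submodule.span κ {z | ∃ y ∈ B, z = y + y ^ Q ∨ z = y ^ (Q + 1)}

/-- Frobenius property. -/
def FrobProp (R : Type*) [Ring R] (Q : ℕ) : Prop :=
  2 ≤ Q ∧ ∀ a b : R, Commute a b → (a + b) ^ Q = a ^ Q + b ^ Q

theorem WW_one {B : Ideal R} {Q : ℕ} {y : R} (hy : y ∈ B) : y + y ^ Q ∈ WW κ B Q :=
  Submodule.subset_span ⟨y, hy, Or.inl rfl⟩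

theorem WW_two {B : Ideal R} {Q : ℕ} {y : R} (hy : y ∈ B) : y ^ (Q + 1) ∈ WW κ B Q :=
  Submodule.subset_span ⟨y, hy, Or.inr rfl⟩

theorem WW_pow_iff {B : Ideal R} {Q : ℕ} {y : R} (hy : y ∈ B) :
    y ^ Q ∈ WW κ B Q ↔ y ∈ WW κ B Q := by
  have h := WW_one (κ := κ) (Q := Q) hy
  constructor
  · intro h2; simpa using Submodule.sub_mem _ h h2
  · intro h2; simpa using Submodule.sub_mem _ h h2

variable {B : Ideal R} {Q : ℕ}

theorem FrobProp.sub (hF : FrobProp R Q) {a b : R} (h : Commute a b) :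
    (a - b) ^ Q = a ^ Q - b ^ Q := by
  have := hF.2 (a - b) b (h.sub_left (Commute.refl b))
  rw [sub_add_cancel] at this
  rw [this]; abel

theorem WW_polar (hF : FrobProp R Q) {a c : R} (ha : a ∈ B) (hc : c ∈ B) (h : Commute a c) :
    a ^ Q * c + a * c ^ Q ∈ WW κ B Q := by
  have h1 := WW_two (κ := κ) (Q := Q) (B.add_mem ha hc)
  have h2 := WW_two (κ := κ) (Q := Q) ha
  have h3 := WW_two (κ := κ) (Q := Q) hc
  have := Submodule.sub_mem _ (Submodule.sub_mem _ h1 h2) h3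
  rw [pow_succ (a + c), hF.2 a c h] at this
  convert this using 1
  have : c ^ Q * a = a * c ^ Q := (h.pow_right Q).symm
  rw [add_mul, mul_add, mul_add, this, pow_succ, pow_succ]; abel

theorem WW_mul_g (hF : FrobProp R Q) [B.IsTwoSided] {a c : R} (ha : a ∈ B) (hc : c ∈ B)
    (h : Commute a c) : a * (c - c ^ (Q ^ 2)) ∈ WW κ B Q := by
  have e : (c - c ^ (Q ^ 2)) ^ Q = c ^ Q - (c ^ (Q ^ 2)) ^ Q :=
    hF.sub ((Commute.refl c).pow_right _)
  have h1 := WW_polar (κ := κ) hF ha hc h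
  have hacQ : a * c ^ Q ∈ B := B.mul_mem_right _ ha
  have h2 := WW_one (κ := κ) (Q := Q) hacQ
  have h3 := Submodule.sub_mem _ h1 h2
  rw [(h.pow_right Q).mul_pow, ← pow_mul, ← pow_two] at h3
  have h4 : a ^ Q * (c - c ^ (Q ^ 2)) ∈ WW κ B Q := by
    convert h3 using 1; rw [mul_sub]; abel
  have hQ0 : Q ≠ 0 := by have := hF.1; omega
  -- apply to a, c with roles
  have h5 : a ^ Q * c ^ Q - a ^ Q * (c ^ (Q ^ 2)) ^ Q ∈ WW κ B Q := by
    have h1 := WW_polar (κ := κ) hF ha (B.pow_mem_of_mem hc Q (by omega)) (h.pow_right Q)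
    have h2 := WW_polar (κ := κ) hF (B.pow_mem_of_mem ha Q (by omega)) hc (h.pow_left Q)
    have h3 := WW_one (κ := κ) (Q := Q) (B.mul_mem_right c (B.pow_mem_of_mem ha Q (by omega)))
    have h6 := WW_one (κ := κ) (Q := Q) (B.mul_mem_right c ha)
    have h7 := WW_one (κ := κ) (Q := Q) (B.mul_mem_right (c ^ (Q^2)) ha)
    rw [h.mul_pow] at h6
    rw [(h.pow_right _).mul_pow] at h7
    have h8 : a * c - a * c ^ (Q^2) ∈ WW κ B Q := by
      have hh := WW_polar (κ := κ) hF (a := c ^ Q) (c := a) (B.pow_mem_of_mem hc Q (by omega)) ha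
        (h.pow_right Q).symm
      have hh2 := h6
      rw [← pow_mul, ← pow_two] at hh
      have e1 : c ^ Q ^ 2 * a = a * c ^ Q ^ 2 := (h.pow_right _).symm
      have e2 : c ^ Q * a ^ Q = a ^ Q * c ^ Q := ((h.pow_right _).pow_left _).symm
      rw [e1, e2] at hh
      convert Submodule.sub_mem _ hh2 hh using 1
      abel
    convert Submodule.sub_mem _ (Submodule.sub_mem _ h6 h7) h8 using 1
    abel
  have h6 := WW_one (κ := κ) (Q := Q) (B.mul_mem_right (c - c ^ (Q ^ 2)) ha)
  have hc2 : Commute a (c - c ^ (Q ^ 2)) := h.sub_right (h.pow_right _)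
  rw [hc2.mul_pow, e, mul_sub (a ^ Q)] at h6
  simpa using Submodule.sub_mem _ h6 h5

theorem WW_g (hF : FrobProp R Q) {c : R} (hc : c ∈ B) : c - c ^ (Q ^ 2) ∈ WW κ B Q := by
  have h1 := WW_one (κ := κ) (Q := Q) hc
  have h2 := WW_one (κ := κ) (Q := Q) (B.pow_mem_of_mem hc Q (by have := hF.1; omega))
  rw [← pow_mul, ← pow_two] at h2
  convert Submodule.sub_mem _ h1 h2 using 1
  abel

theorem WW_one_add_mul_g (hF : FrobProp R Q) [B.IsTwoSided] {a c : R} (ha : a ∈ B) (hc : c ∈ B)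
    (h : Commute a c) : (1 + a) * (c - c ^ (Q ^ 2)) ∈ WW κ B Q := by
  rw [add_mul, one_mul]
  exact Submodule.add_mem _ (WW_g hF hc) (WW_mul_g hF ha hc h)

theorem WW_of_isUnit (hF : FrobProp R Q) [B.IsTwoSided] {b : R} (hb : b ∈ B)
    (hu : IsUnit (1 - b ^ (Q ^ 2 - 1))) : b ∈ WW κ B Q := by
  obtain ⟨u, hu⟩ := hu
  have hQ : 2 ≤ Q := hF.1
  have hQ2 : 4 ≤ Q ^ 2 := by nlinarith
  have hcu : Commute (u : R) b := by
    rw [hu]; exact ((Commute.one_left b).sub_left ((Commute.refl b).pow_left _))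
  have hcui : Commute (↑u⁻¹ : R) b := Commute.units_inv_left hcu
  have hmem : (↑u⁻¹ : R) - 1 ∈ B := by
    have : (↑u⁻¹ : R) - 1 = ↑u⁻¹ * (1 - u) := by rw [mul_sub, mul_one, Units.inv_mul]
    rw [this, hu]
    apply B.mul_mem_left
    simpa using B.pow_mem_of_mem hb (Q^2-1) (by omega)
  have := WW_one_add_mul_g (κ := κ) hF hmem hb (hcui.sub_left (Commute.one_left b))
  have e : b - b ^ Q ^ 2 = u * b := by
    rw [hu, sub_mul, one_mul, ← pow_succ]; congr 2; omega
  rw [add_sub_cancel, e, ← mul_assoc, Units.inv_mul, one_mul] at this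
  exact this

theorem WW_of_isNilpotent (hF : FrobProp R Q) [B.IsTwoSided] {b : R} (hb : b ∈ B)
    (hn : IsNilpotent b) : b ∈ WW κ B Q := by
  apply WW_of_isUnit hF hb
  apply IsNilpotent.isUnit_one_sub
  have hQ : 2 ≤ Q := hF.1
  have hQ2 : 4 ≤ Q ^ 2 := by nlinarith
  exact hn.pow_of_pos (by omega)

theorem isUnit_one_sub_of_mem_jacobson {x : R} (hx : x ∈ Ring.jacobson R) : IsUnit (1 - x) := by
  have key : ∀ z ∈ Ring.jacobson R, ∃ w, w * (1 - z) = 1 := by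
    intro z hz
    rw [← Ideal.jacobson_bot, Ideal.mem_jacobson_iff] at hz
    obtain ⟨w, hw⟩ := hz (-1)
    refine ⟨w, ?_⟩
    have : w * -1 * z + w - 1 = 0 := by simpa using hw
    rw [mul_sub, mul_one]
    rw [mul_neg_one, neg_mul] at this
    have h2 := sub_eq_zero.1 this
    rw [← h2]; abel
  obtain ⟨w, hw⟩ := key x hx
  have hw' : 1 - w ∈ Ring.jacobson R := by
    have : 1 - w = -(w * x) := by
      rw [mul_sub, mul_one] at hw
      rw [← hw]; abel
    rw [this]
    exact neg_mem (Ideal.mul_mem_left _ _ hx)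
  obtain ⟨z, hz⟩ := key _ hw'
  rw [sub_sub_cancel] at hz
  have : z = 1 - x := by
    calc z = z * (w * (1 - x)) := by rw [hw, mul_one]
      _ = 1 - x := by rw [← mul_assoc, hz, one_mul]
  exact ⟨⟨1 - x, w, by rw [← this, hz], hw⟩, rfl⟩

theorem WW_of_jacobson (hF : FrobProp R Q) [B.IsTwoSided] {b : R} (hb : b ∈ B)
    (hn : b ∈ Ring.jacobson R) : b ∈ WW κ B Q := by
  apply WW_of_isUnit hF hb
  apply isUnit_one_sub_of_mem_jacobson
  have hQ : 2 ≤ Q := hF.1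
  have hQ2 : 4 ≤ Q ^ 2 := by nlinarith
  exact Ideal.pow_mem_of_mem _ hn _ (by omega)

theorem WW_idem_mul [B.IsTwoSided] (hQ : 2 ≤ Q) {e w : R} (he : e * e = e)
    (hc : ∀ r, e * r = r * e)
    (hw : w ∈ WW κ B Q) : e * w ∈ WW κ B Q := by
  have hp : ∀ y : R, ∀ m : ℕ, m ≠ 0 → e * y ^ m = (e * y) ^ m := by
    intro y m hm
    have hce : Commute e y := hc y
    rw [hce.mul_pow, IsIdempotentElem.pow_eq he hm]
  induction hw using Submodule.span_induction with
  | mem x hx =>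
    obtain ⟨y, hy, rfl | rfl⟩ := hx
    · rw [mul_add, hp y Q (by omega)]
      exact WW_one (B.mul_mem_left _ hy)
    · rw [hp y _ (by omega)]
      exact WW_two (B.mul_mem_left _ hy)
  | zero => simp
  | add x y _ _ hx hy => rw [mul_add]; exact Submodule.add_mem _ hx hy
  | smul a x _ hx => rw [mul_smul_comm]; exact Submodule.smul_mem _ _ hx

theorem WW_mul_idem_sub [B.IsTwoSided] (hQ : 2 ≤ Q) {e w : R} (he : e * e = e)
    (hc : ∀ r, e * r = r * e)
    (hw : w ∈ WW κ B Q) : (1 - e) * w ∈ WW κ B Q := by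
  rw [sub_mul, one_mul]
  exact Submodule.sub_mem _ hw (WW_idem_mul hQ he hc hw)

end PartB

section PartCrit
variable {κ R : Type*} [Field κ] [Ring R] [Algebra κ R]

/-- A minimal counterexample. -/
structure Crit (κ : Type*) {R : Type*} [Field κ] [Ring R] [Algebra κ R] (B : Ideal R) (Q : ℕ)
    (v : R) : Prop where
  two : B.IsTwoSided
  frob : FrobProp R Q
  notMem : v ∉ WW κ B Q
  max : ∀ K : Ideal R, K.IsTwoSided → K ≠ ⊥ → ∃ w ∈ WW κ B Q, v - w ∈ K

variable {B : Ideal R} {Q : ℕ} {v : R}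

theorem Crit.eq_bot (h : Crit κ B Q v) (K : Ideal R) (hK : K.IsTwoSided)
    (hW : ∀ x ∈ K, x ∈ WW κ B Q) : K = ⊥ := by
  by_contra hne
  obtain ⟨w, hw, hvw⟩ := h.max K hK hne
  apply h.notMem
  simpa using Submodule.add_mem _ (hW _ hvw) hw

theorem Crit.eq_zero' (h : Crit κ B Q v) {t : R} (ht : ∀ r s, r * t * s ∈ WW κ B Q) : t = 0 := by
  let K : Ideal R :=
    { carrier := {t | ∀ r s, r * t * s ∈ WW κ B Q}
      add_mem' := by
        intro a b ha hb r s
        rw [mul_add, add_mul]; exact Submodule.add_mem _ (ha r s) (hb r s)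
      zero_mem' := by intro r s; simp
      smul_mem' := by
        intro c a ha r s
        rw [smul_eq_mul, ← mul_assoc]; exact ha _ _ }
  have hK : K.IsTwoSided := ⟨fun b ha r s => by
    rw [← mul_assoc, mul_assoc]; exact ha _ _⟩
  have := h.eq_bot K hK (fun x hx => by simpa using hx 1 1)
  have ht' : t ∈ K := ht
  rw [this] at ht'
  simpa using ht'

theorem Crit.eq_zero_of_mul (h : Crit κ B Q v) {t : R} (htB : t ∈ B)
    (ht : ∀ y ∈ B, ∀ z ∈ B, y * t * z = 0) : t = 0 := by
  have := h.two
  apply h.eq_zero'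
  intro r s
  apply WW_of_isNilpotent h.frob (B.mul_mem_right _ (B.mul_mem_left _ htB))
  refine ⟨3, ?_⟩
  have : (r * t * s) ^ 3 = r * ((t * (s * r)) * t * (s * r * t)) * s := by
    simp only [pow_succ, pow_zero, one_mul, mul_assoc]
  rw [this, ht _ (B.mul_mem_right _ htB) _ (B.mul_mem_left _ htB)]
  simp

theorem Crit.eq_zero (h : Crit κ B Q v) {t : R} (htB : t ∈ B)
    (ht : ∀ y ∈ B, ∀ z ∈ B, y * t * z ∈ WW κ B Q) : t = 0 := by
  have := h.two
  apply h.eq_zero_of_mul htB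
  intro y hy z hz
  apply h.eq_zero'
  intro r s
  have : r * (y * t * z) * s = (r * y) * t * (z * s) := by simp only [mul_assoc]
  rw [this]
  exact ht _ (B.mul_mem_left _ hy) _ (B.mul_mem_right _ hz)

theorem Crit.jacobson (h : Crit κ B Q v) {t : R} (htB : t ∈ B) (hJ : t ∈ Ring.jacobson R) :
    t = 0 := by
  have := h.two
  apply h.eq_zero'
  intro r s
  exact WW_of_jacobson h.frob (B.mul_mem_right _ (B.mul_mem_left _ htB))
    (Ideal.mul_mem_right _ _ (Ideal.mul_mem_left _ _ hJ))

theorem Crit.central (h : Crit κ B Q v) {c : R} (hc : c ∈ B) (hcc : ∀ r, c * r = r * c) :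
    c ^ (Q ^ 2) = c := by
  have := h.two
  have hQ := h.frob.1
  have hcB : c - c ^ Q ^ 2 ∈ B := B.sub_mem hc (B.pow_mem_of_mem hc _ (by positivity))
  have : c - c ^ (Q ^ 2) = 0 := by
    apply h.eq_zero hcB
    intro y hy z hz
    have hcomm : Commute (c - c ^ Q ^ 2) z :=
      Commute.sub_left (hcc z) (Commute.pow_left (hcc z) _)
    rw [mul_assoc, hcomm.eq, ← mul_assoc]
    exact WW_mul_g h.frob (B.mul_mem_right _ hy) hc (hcc _).symm
  exact (sub_eq_zero.1 this).symm

theorem Crit.nontrivial (h : Crit κ B Q v) : Nontrivial R := by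
  by_contra hn
  rw [not_nontrivial_iff_subsingleton] at hn
  exact h.notMem (by rw [Subsingleton.elim v 0]; exact Submodule.zero_mem _)

end PartCrit

section PartC
variable {R ι : Type*} [Ring R] [DecidableEq ι]

/-- polarization of the power map -/
def GG (x : ι → R) (s : Finset ι) (m : ℕ) : R :=
  ∑ T ∈ s.powerset, (-1) ^ (s \ T).card * (∑ i ∈ T, x i) ^ m

theorem GG_congr {x y : ι → R} {s : Finset ι} (h : ∀ i ∈ s, x i = y i) (m : ℕ) :
    GG x s m = GG y s m := by
  unfold GG
  refine Finset.sum_congr rfl fun T hT => ?_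
  rw [Finset.sum_congr rfl fun i hi => h i (Finset.mem_powerset.1 hT hi)]

theorem GG_split (x : ι → R) (s : Finset ι) (m : ℕ) {i : ι} (hi : i ∈ s) :
    ∑ T ∈ s.powerset with i ∈ T, (-1) ^ (s \ T).card * (∑ i ∈ T, x i) ^ m
      = GG x s m + GG x (s.erase i) m := by
  rw [GG, ← Finset.sum_filter_add_sum_filter_not s.powerset (fun T => i ∈ T), add_assoc]
  have : Finset.filter (fun T => i ∉ T) s.powerset = (s.erase i).powerset := by
    ext T; simp [Finset.subset_erase]
  rw [this, GG, ← Finset.sum_add_distrib]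
  symm
  rw [add_eq_left]
  refine Finset.sum_eq_zero fun T hT => ?_
  have hT' := Finset.mem_powerset.1 hT
  have hiT : i ∉ T := (Finset.subset_erase.1 hT').2
  have : (s \ T).card = (s.erase i \ T).card + 1 := by
    rw [Finset.erase_sdiff_comm, Finset.card_erase_add_one]
    simp [hi, hiT]
  rw [this, pow_succ]; simp

theorem GG_succ (x : ι → R) (s : Finset ι) (m : ℕ) :
    GG x s (m + 1) = ∑ i ∈ s, x i * (GG x s m + GG x (s.erase i) m) := by
  have : ∀ i ∈ s, x i * (GG x s m + GG x (s.erase i) m) =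
      ∑ T ∈ s.powerset, if i ∈ T then (-1) ^ (s \ T).card * (x i * (∑ i ∈ T, x i) ^ m) else 0 := by
    intro i hi
    rw [← GG_split x s m hi, Finset.mul_sum, Finset.sum_filter]
    refine Finset.sum_congr rfl fun T hT => ?_
    split_ifs with h
    · rw [← mul_assoc, ← mul_assoc, ((Commute.neg_one_right (x i)).pow_right _).eq]
    · rfl
  rw [Finset.sum_congr rfl this, Finset.sum_comm, GG]
  refine Finset.sum_congr rfl fun T hT => ?_
  have hT' := Finset.mem_powerset.1 hT
  rw [← Finset.sum_filter, Finset.filter_mem_eq_inter, Finset.inter_eq_right.2 hT', pow_succ',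
    ← Finset.mul_sum, Finset.sum_mul]

theorem GG_zero (x : ι → R) (s : Finset ι) (hs : s.Nonempty) : GG x s 0 = 0 := by
  obtain ⟨i, hi⟩ := hs
  have h1 := GG_split x s 0 hi
  rw [GG]
  simp only [pow_zero, mul_one]
  have : ∑ T ∈ s.powerset, (-1 : R) ^ (s \ T).card = ∑ T ∈ s.powerset, (-1 : R) ^ (T).card := by
    refine Finset.sum_bij' (fun T _ => s \ T) (fun T _ => s \ T) ?_ ?_ ?_ ?_ ?_
    · intro T hT; simp
    · intro T hT; simp
    · intro T hT; simp [Finset.inter_eq_right.2 (Finset.mem_powerset.1 hT)]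
    · intro T hT; simp [Finset.inter_eq_right.2 (Finset.mem_powerset.1 hT)]
    · intro T hT; simp
  rw [this]
  have h2 := Finset.sum_powerset_neg_one_pow_card_of_nonempty (x := s) ⟨i, hi⟩
  have h3 := congrArg (Int.cast : ℤ → R) h2
  push_cast at h3
  exact h3

theorem GG_lt (x : ι → R) (m : ℕ) : ∀ (s : Finset ι), m < s.card → GG x s m = 0 := by
  induction m with
  | zero => intro s hs; exact GG_zero x s (Finset.card_pos.1 hs)
  | succ m ih =>
    intro s hs
    rw [GG_succ]
    refine Finset.sum_eq_zero fun i hi => ?_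
    rw [ih s (by omega), ih _ (by rw [Finset.card_erase_of_mem hi]; omega)]; simp

/-- full symmetrization -/
def SS (x : ι → R) (s : Finset ι) : R := GG x s s.card

theorem SS_congr {x y : ι → R} {s : Finset ι} (h : ∀ i ∈ s, x i = y i) :
    SS x s = SS y s := GG_congr h _

theorem SS_empty (x : ι → R) : SS x ∅ = 1 := by simp [SS, GG]

theorem SS_rec (x : ι → R) (s : Finset ι) (hs : s.Nonempty) :
    SS x s = ∑ i ∈ s, x i * SS x (s.erase i) := by
  obtain ⟨m, hm⟩ : ∃ m, s.card = m + 1 := ⟨s.card - 1, by have := Finset.card_pos.2 hs; omega⟩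
  rw [SS, hm, GG_succ]
  refine Finset.sum_congr rfl fun i hi => ?_
  rw [GG_lt x m s (by omega), zero_add, SS, Finset.card_erase_of_mem hi, hm]; rfl

theorem SS_merge (x : ι → R) (j : ι) (m : ℕ) : ∀ (s : Finset ι), s.card = m → j ∉ s →
    SS x (insert j s) = SS x s * x j + ∑ i ∈ s, SS (Function.update x i (x j * x i)) s := by
  induction m with
  | zero =>
    intro s hs hj
    rw [Finset.card_eq_zero] at hs
    subst hs
    rw [SS_rec _ _ (Finset.insert_nonempty _ _)]
    simp [SS_empty]
  | succ m ih =>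
    intro s hs hj
    have hne : s.Nonempty := Finset.card_pos.1 (by omega)
    rw [SS_rec _ _ (Finset.insert_nonempty _ _), Finset.sum_insert hj, Finset.erase_insert hj]
    have h1 : ∀ i ∈ s, x i * SS x ((insert j s).erase i) =
        x i * SS x (s.erase i) * x j +
          ∑ l ∈ s.erase i, x i * SS (Function.update x l (x j * x l)) (s.erase i) := by
      intro i hi
      have hij : i ≠ j := by rintro rfl; exact hj hi
      rw [Finset.erase_insert_of_ne hij.symm, ih _ (by rw [Finset.card_erase_of_mem hi]; omega)
        (fun h => hj (Finset.mem_of_mem_erase h)), mul_add, mul_assoc, Finset.mul_sum]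
    have h2 : ∀ l ∈ s, SS (Function.update x l (x j * x l)) s =
        x j * (x l * SS x (s.erase l)) +
          ∑ i ∈ s.erase l, x i * SS (Function.update x l (x j * x l)) (s.erase i) := by
      intro l hl
      rw [SS_rec _ _ hne, ← Finset.add_sum_erase _ _ hl, Function.update_self, mul_assoc]
      congr 1
      · congr 2
        apply SS_congr
        intro i hi
        rw [Function.update_of_ne (Finset.ne_of_mem_erase hi)]
      · refine Finset.sum_congr rfl fun i hi => ?_
        rw [Function.update_of_ne (Finset.ne_of_mem_erase hi)]
    rw [Finset.sum_congr rfl h1, Finset.sum_congr rfl h2, Finset.sum_add_distrib,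
      Finset.sum_add_distrib, ← Finset.sum_mul, ← Finset.mul_sum, ← SS_rec x s hne]
    have h3 : ∑ i ∈ s, ∑ l ∈ s.erase i, x i * SS (Function.update x l (x j * x l)) (s.erase i)
        = ∑ l ∈ s, ∑ i ∈ s.erase l, x i * SS (Function.update x l (x j * x l)) (s.erase i) := by
      apply Finset.sum_comm'
      intro a b
      simp only [Finset.mem_erase]
      tauto
    rw [h3]; abel

theorem SS_deriv (x : ι → R) (y : R) (m : ℕ) : ∀ (s : Finset ι), s.card = m →
    y * SS x s = SS x s * y + ∑ i ∈ s, SS (Function.update x i (y * x i - x i * y)) s := by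
  induction m with
  | zero =>
    intro s hs
    rw [Finset.card_eq_zero] at hs
    subst hs
    simp [SS_empty]
  | succ m ih =>
    intro s hs
    have hne : s.Nonempty := Finset.card_pos.1 (by omega)
    have h1 : ∀ i ∈ s, y * (x i * SS x (s.erase i)) = (y * x i - x i * y) * SS x (s.erase i) +
        (x i * SS x (s.erase i) * y +
          ∑ l ∈ s.erase i, x i * SS (Function.update x l (y * x l - x l * y)) (s.erase i)) := by
      intro i hi
      have := ih (s.erase i) (by rw [Finset.card_erase_of_mem hi]; omega)
      rw [← Finset.mul_sum, mul_assoc, ← mul_add, ← this]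
      noncomm_ring
    have h2 : ∀ l ∈ s, SS (Function.update x l (y * x l - x l * y)) s =
        (y * x l - x l * y) * SS x (s.erase l) +
          ∑ i ∈ s.erase l, x i * SS (Function.update x l (y * x l - x l * y)) (s.erase i) := by
      intro l hl
      rw [SS_rec _ _ hne, ← Finset.add_sum_erase _ _ hl, Function.update_self]
      congr 1
      · congr 1
        apply SS_congr
        intro i hi
        rw [Function.update_of_ne (Finset.ne_of_mem_erase hi)]
      · refine Finset.sum_congr rfl fun i hi => ?_
        rw [Function.update_of_ne (Finset.ne_of_mem_erase hi)]
    have h3 : ∑ i ∈ s, ∑ l ∈ s.erase i,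
          x i * SS (Function.update x l (y * x l - x l * y)) (s.erase i)
        = ∑ l ∈ s, ∑ i ∈ s.erase l,
          x i * SS (Function.update x l (y * x l - x l * y)) (s.erase i) := by
      apply Finset.sum_comm'
      intro a b
      simp only [Finset.mem_erase]
      tauto
    rw [SS_rec x s hne, Finset.mul_sum, Finset.sum_congr rfl h1, Finset.sum_congr rfl h2]
    simp only [Finset.sum_add_distrib]
    rw [← Finset.sum_mul, h3]; abel

end PartC

section PartC2
variable {κ R : Type*} [Field κ] [Ring R] [Algebra κ R]
variable {B : Ideal R} {Q : ℕ} {v : R} {ι : Type*} [DecidableEq ι]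

theorem WW_SS_Q (hQ : 2 ≤ Q) {x : ι → R} {s : Finset ι} (hs : s.card = Q)
    (hx : ∀ i ∈ s, x i ∈ B) : SS x s ∈ WW κ B Q := by
  have h1 : GG x s 1 = 0 := GG_lt x 1 s (by omega)
  have : SS x s = ∑ T ∈ s.powerset, (-1 : R) ^ (s \ T).card * ((∑ i ∈ T, x i) + (∑ i ∈ T, x i) ^ Q) := by
    simp only [mul_add, Finset.sum_add_distrib]
    rw [SS, hs]
    simp only [GG, pow_one] at h1
    rw [h1, zero_add, GG]
  rw [this]
  refine Submodule.sum_mem _ fun T hT => ?_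
  have hm := WW_one (κ := κ) (Q := Q) (B.sum_mem (t := T) (f := x)
    fun i hi => hx i (Finset.mem_powerset.1 hT hi))
  rcases neg_one_pow_eq_or R (s \ T).card with h | h <;> rw [h]
  · simpa using hm
  · rw [neg_one_mul]; exact Submodule.neg_mem _ hm

theorem WW_SS_Q1 {x : ι → R} {s : Finset ι} (hs : s.card = Q + 1)
    (hx : ∀ i ∈ s, x i ∈ B) : SS x s ∈ WW κ B Q := by
  rw [SS, hs]
  refine Submodule.sum_mem _ fun T hT => ?_
  have hm := WW_two (κ := κ) (Q := Q) (B.sum_mem (t := T) (f := x)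
    fun i hi => hx i (Finset.mem_powerset.1 hT hi))
  rcases neg_one_pow_eq_or R (s \ T).card with h | h <;> rw [h]
  · simpa using hm
  · rw [neg_one_mul]; exact Submodule.neg_mem _ hm

theorem WW_SS_mul (hQ : 2 ≤ Q) {x : ℕ → R} (hx : ∀ i, x i ∈ B) {y : R} (hy : y ∈ B) :
    SS x (Finset.range Q) * y ∈ WW κ B Q := by
  set x' := Function.update x Q y with hx'
  have hxy : ∀ i ∈ Finset.range Q, x' i = x i := by
    intro i hi
    have := Finset.mem_range.1 hi
    rw [hx', Function.update_of_ne (by omega)]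
  have hB : ∀ i, x' i ∈ B := by
    intro i
    rw [hx']
    rcases eq_or_ne i Q with rfl | h
    · simpa using hy
    · rw [Function.update_of_ne h]; exact hx i
  have h1 := SS_merge x' Q Q (Finset.range Q) (by simp) (by simp)
  have h2 : x' Q = y := by simp [hx']
  rw [SS_congr hxy, h2] at h1
  have h3 : SS x (Finset.range Q) * y = SS x' (insert Q (Finset.range Q)) -
    ∑ i ∈ Finset.range Q, SS (Function.update x' i (y * x' i)) (Finset.range Q) := by
      rw [h1]; abel
  rw [h3]
  refine Submodule.sub_mem _ (WW_SS_Q1 (by simp) fun i _ => hB i)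
    (Submodule.sum_mem _ fun i _ => WW_SS_Q hQ (by simp) fun l _ => ?_)
  rcases eq_or_ne l i with rfl | h
  · simpa using B.mul_mem_left _ (hB l)
  · rw [Function.update_of_ne h]; exact hB l

theorem Crit.PI (h : Crit κ B Q v) {x : ℕ → R} (hx : ∀ i, x i ∈ B) :
    SS x (Finset.range Q) = 0 := by
  have := h.two
  have hQ := h.frob.1
  apply h.eq_zero
  · rw [SS_rec _ _ ⟨0, by simp; omega⟩]
    exact B.sum_mem fun i _ => B.mul_mem_right _ (hx i)
  intro y hy z hz
  rw [SS_deriv x y Q (Finset.range Q) (by simp), add_mul, Finset.sum_mul, mul_assoc]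
  refine Submodule.add_mem _ (WW_SS_mul hQ hx (B.mul_mem_left _ hz))
    (Submodule.sum_mem _ fun i _ => WW_SS_mul hQ (fun l => ?_) hz)
  rcases eq_or_ne l i with rfl | h
  · simpa using B.sub_mem (B.mul_mem_left _ (hx l)) (B.mul_mem_left _ hy)
  · rw [Function.update_of_ne h]; exact hx l

end PartC2

section PartRep1

theorem exists_max_comm (D : Type*) [DivisionRing D] :
    ∃ L : Subfield D, (∀ x ∈ L, ∀ y ∈ L, x * y = y * x) ∧
      ∀ x, (∀ y ∈ L, x * y = y * x) → x ∈ L := by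
  obtain ⟨m, hm⟩ := zorn_subset {s : Set D | ∀ x ∈ s, ∀ y ∈ s, x * y = y * x} (by
    intro c hc hchain
    refine ⟨⋃₀ c, ?_, fun s hs => Set.subset_sUnion_of_mem hs⟩
    rintro x ⟨s, hs, hxs⟩ y ⟨t, ht, hyt⟩
    rcases hchain.total hs ht with h | h
    · exact hc ht x (h hxs) y hyt
    · exact hc hs x hxs y (h hyt))
  have hcen : ∀ x, (∀ y ∈ m, x * y = y * x) → x ∈ m := by
    intro x hx
    have h1 : insert x m ∈ {s : Set D | ∀ x ∈ s, ∀ y ∈ s, x * y = y * x} := by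
      intro a ha b hb
      rcases ha with rfl | ha <;> rcases hb with rfl | hb
      · rfl
      · exact hx b hb
      · exact (hx a ha).symm
      · exact hm.prop a ha b hb
    exact hm.le_of_ge h1 (Set.subset_insert _ _) (Set.mem_insert _ _)
  refine ⟨{ carrier := m, mul_mem' := ?_, one_mem' := ?_, add_mem' := ?_, zero_mem' := ?_,
            neg_mem' := ?_, inv_mem' := ?_ }, hm.prop, hcen⟩
  · intro a b ha hb
    refine hcen _ fun y hy => ?_
    exact (Commute.mul_left (hm.prop a ha y hy : Commute a y) (hm.prop b hb y hy)).eq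
  · exact hcen _ fun y hy => by simp
  · intro a b ha hb
    refine hcen _ fun y hy => ?_
    exact (Commute.add_left (hm.prop a ha y hy : Commute a y) (hm.prop b hb y hy)).eq
  · exact hcen _ fun y hy => by simp
  · intro a ha
    refine hcen _ fun y hy => ?_
    exact (Commute.neg_left (hm.prop a ha y hy : Commute a y)).eq
  · intro a ha
    refine hcen _ fun y hy => ?_
    exact (Commute.inv_left₀ (hm.prop a ha y hy : Commute a y)).eq

variable {R L V : Type*} [Ring R] [Field L] [AddCommGroup V] [Module L V]

theorem rep_density (ρ : R →+* Module.End L V) (hV : Nontrivial V)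
    (hs : ∀ N : AddSubgroup V, (∀ r, ∀ x ∈ N, ρ r x ∈ N) → N = ⊥ ∨ N = ⊤)
    (hcent : ∀ f : V →+ V, (∀ r x, f (ρ r x) = ρ r (f x)) → (∀ (l : L) x, f (l • x) = l • f x) →
      ∃ l : L, ∀ x, f x = l • x)
    (f : Module.End L V) (s : Finset V) :
    ∃ t ∈ Algebra.adjoin L (Set.range ρ), ∀ m ∈ s, f m = t m := by
  set S := Algebra.adjoin L (Set.range ρ) with hS
  have hsimp : IsSimpleModule S V := by
    rw [isSimpleModule_iff]
    refine { exists_pair_ne := ⟨⊥, ⊤, bot_ne_top⟩, eq_bot_or_eq_top := fun N => ?_ }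
    have h := hs N.toAddSubgroup (fun r x hx =>
      N.smul_mem (⟨ρ r, Algebra.subset_adjoin ⟨r, rfl⟩⟩ : S) hx)
    rcases h with h | h
    · left
      apply Submodule.toAddSubgroup_injective
      rw [h]; rfl
    · right
      apply Submodule.toAddSubgroup_injective
      rw [h]; rfl
  let f' : Module.End (Module.End S V) V :=
    { toFun := f
      map_add' := f.map_add
      map_smul' := by
        intro φ x
        obtain ⟨l, hl⟩ := hcent φ.toAddMonoidHom
          (fun r x => φ.map_smul (⟨ρ r, Algebra.subset_adjoin ⟨r, rfl⟩⟩ : S) x)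
          (fun l x => φ.map_smul (algebraMap L S l) x)
        have hl' : ∀ x, φ x = l • x := hl
        simp only [Module.End.smul_def, RingHom.id_apply]
        rw [hl', hl', map_smul] }
  obtain ⟨r, hr⟩ := jacobson_density (R := S) f' s
  exact ⟨r, r.2, hr⟩

theorem exists_linearMap_of_li {n : ℕ} {w : Fin n → V} (hw : LinearIndependent L w)
    (u : Fin n → V) : ∃ f : Module.End L V, ∀ i, f (w i) = u i := by
  obtain ⟨g, hg⟩ := LinearMap.exists_extend ((Module.Basis.span hw).constr L u)
  refine ⟨g, fun i => ?_⟩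
  have := (Module.Basis.span hw).constr_basis L u i
  rw [← this, ← hg]
  simp [Module.Basis.span_apply]

end PartRep1

section PartRep2
variable {A L ι : Type*} [Field L] [Ring A] [Algebra L A] [DecidableEq ι]

theorem SS_update_add (x : ι → A) (i : ι) (a b : A) (m : ℕ) : ∀ s : Finset ι, s.card = m → i ∈ s →
    SS (Function.update x i (a + b)) s =
      SS (Function.update x i a) s + SS (Function.update x i b) s := by
  induction m with
  | zero => intro s hs hi; rw [Finset.card_eq_zero] at hs; subst hs; simp at hi
  | succ m ih =>
    intro s hs hi
    have hne : s.Nonempty := ⟨i, hi⟩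
    rw [SS_rec _ s hne, SS_rec _ s hne, SS_rec _ s hne, ← Finset.sum_add_distrib]
    refine Finset.sum_congr rfl fun l hl => ?_
    rcases eq_or_ne l i with rfl | h
    · simp only [Function.update_self, add_mul]
      congr 2 <;>
      · apply SS_congr
        intro j hj
        rw [Function.update_of_ne (Finset.ne_of_mem_erase hj),
          Function.update_of_ne (Finset.ne_of_mem_erase hj)]
    · simp only [Function.update_of_ne h]
      rw [ih (s.erase l) (by rw [Finset.card_erase_of_mem hl]; omega)
        (Finset.mem_erase.2 ⟨h.symm, hi⟩), mul_add]

theorem SS_update_smul (x : ι → A) (i : ι) (c : L) (a : A) (m : ℕ) :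
    ∀ s : Finset ι, s.card = m → i ∈ s →
    SS (Function.update x i (c • a)) s = c • SS (Function.update x i a) s := by
  induction m with
  | zero => intro s hs hi; rw [Finset.card_eq_zero] at hs; subst hs; simp at hi
  | succ m ih =>
    intro s hs hi
    have hne : s.Nonempty := ⟨i, hi⟩
    rw [SS_rec _ s hne, SS_rec _ s hne, Finset.smul_sum]
    refine Finset.sum_congr rfl fun l hl => ?_
    rcases eq_or_ne l i with rfl | h
    · simp only [Function.update_self, smul_mul_assoc]
      congr 2
      apply SS_congr
      intro j hj
      rw [Function.update_of_ne (Finset.ne_of_mem_erase hj),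
        Function.update_of_ne (Finset.ne_of_mem_erase hj)]
    · simp only [Function.update_of_ne h]
      rw [ih (s.erase l) (by rw [Finset.card_erase_of_mem hl]; omega)
        (Finset.mem_erase.2 ⟨h.symm, hi⟩), mul_smul_comm]

theorem SS_span (C : Set A) (s : Finset ι) (hC : ∀ x : ι → A, (∀ i ∈ s, x i ∈ C) → SS x s = 0)
    (x : ι → A) (hx : ∀ i ∈ s, x i ∈ Submodule.span L C) : SS x s = 0 := by
  have key : ∀ t : Finset ι, t ⊆ s → ∀ x : ι → A, (∀ i ∈ t, x i ∈ Submodule.span L C) →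
      (∀ i ∈ s, i ∉ t → x i ∈ C) → SS x s = 0 := by
    intro t
    induction t using Finset.induction_on with
    | empty => intro _ x _ h2; exact hC x fun i hi => h2 i hi (by simp)
    | insert i t hi ih =>
      intro hts x h1 h2
      have his : i ∈ s := hts (Finset.mem_insert_self _ _)
      have : ∀ z ∈ Submodule.span L C, SS (Function.update x i z) s = 0 := by
        intro z hz
        induction hz using Submodule.span_induction with
        | mem z hz =>
          apply ih (fun l hl => hts (Finset.mem_insert_of_mem hl))
          · intro l hl
            have : l ≠ i := by rintro rfl; exact hi hl
            rw [Function.update_of_ne this]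
            exact h1 l (Finset.mem_insert_of_mem hl)
          · intro l hls hlt
            rcases eq_or_ne l i with rfl | h
            · simpa using hz
            · rw [Function.update_of_ne h]
              exact h2 l hls (by simp [h, hlt])
        | zero =>
          have := SS_update_smul x i (0 : L) 0 _ s rfl his
          simpa using this
        | add a b _ _ ha hb => rw [SS_update_add x i a b _ s rfl his, ha, hb, add_zero]
        | smul c a _ ha => rw [SS_update_smul x i c a _ s rfl his, ha, smul_zero]
      have h3 := this (x i) (h1 i (Finset.mem_insert_self _ _))
      rwa [Function.update_eq_self] at h3
  exact key s (Finset.Subset.refl _) x hx fun i hi h => absurd hi h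

end PartRep2

section PartRep3
variable {L V : Type*} [Field L] [AddCommGroup V] [Module L V]

theorem SS_shift (x : ℕ → Module.End L V) (w : ℕ → V) (Q : ℕ)
    (h1 : ∀ i < Q, x i (w i) = w (i + 1)) (h2 : ∀ i < Q, ∀ j ≤ Q, j ≠ i → x i (w j) = 0) (m : ℕ) :
    ∀ s : Finset ℕ, s.card = m → (∀ i ∈ s, i < Q) →
      SS x s (w 0) = if s = Finset.range m then w m else 0 := by
  induction m with
  | zero => intro s hs _; rw [Finset.card_eq_zero] at hs; subst hs; simp [SS_empty]
  | succ m ih =>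
    intro s hs hsQ
    have hne : s.Nonempty := Finset.card_pos.1 (by omega)
    have hmQ : m < Q := by
      have : s ⊆ Finset.range Q := fun i hi => Finset.mem_range.2 (hsQ i hi)
      have := Finset.card_le_card this
      rw [Finset.card_range] at this
      omega
    rw [SS_rec x s hne, LinearMap.sum_apply]
    have h3 : ∀ i ∈ s, (x i * SS x (s.erase i)) (w 0) =
        if i = m ∧ s = Finset.range (m + 1) then w (m + 1) else 0 := by
      intro i hi
      rw [Module.End.mul_apply, ih (s.erase i) (by rw [Finset.card_erase_of_mem hi]; omega)
        (fun l hl => hsQ l (Finset.mem_of_mem_erase hl))]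
      by_cases hc : s.erase i = Finset.range m
      · rw [if_pos hc]
        by_cases him : i = m
        · subst him
          have hsr : s = Finset.range (i + 1) := by
            rw [Finset.range_add_one, ← hc, Finset.insert_erase hi]
          rw [h1 i hmQ, if_pos ⟨rfl, hsr⟩]
        · rw [h2 i (hsQ i hi) m hmQ.le (Ne.symm him), if_neg (fun h => him h.1)]
      · rw [if_neg hc, map_zero, if_neg]
        rintro ⟨rfl, h⟩
        apply hc
        rw [h, Finset.range_add_one, Finset.erase_insert (by simp)]
    rw [Finset.sum_congr rfl h3]
    by_cases h : s = Finset.range (m + 1)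
    · rw [if_pos h]
      simp only [h, and_true]
      rw [Finset.sum_ite_eq' , if_pos (by simp)]
    · simp [h]

variable {R : Type*} [Ring R]

theorem rep_core (ρ : R →+* Module.End L V) (hV : Nontrivial V)
    (hs : ∀ N : AddSubgroup V, (∀ r, ∀ x ∈ N, ρ r x ∈ N) → N = ⊥ ∨ N = ⊤)
    (hcent : ∀ f : V →+ V, (∀ r x, f (ρ r x) = ρ r (f x)) → (∀ (l : L) x, f (l • x) = l • f x) →
      ∃ l : L, ∀ x, f x = l • x)
    (B : Ideal R) (hB : B.IsTwoSided) (Q : ℕ)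
    (hPI : ∀ x : ℕ → R, (∀ i, x i ∈ B) → SS x (Finset.range Q) = 0)
    {y : R} (hy : y ∈ B) (hy0 : ρ y ≠ 0) :
    ∃ n, 0 < n ∧ n ≤ Q ∧ ∃ e : Module.End L V ≃ₐ[L] Matrix (Fin n) (Fin n) L,
      Submodule.span L (Set.range fun r => e (ρ r)) = ⊤ := by
  have hmap : ∀ (x : ℕ → R) (s : Finset ℕ), ρ (SS x s) = SS (fun i => ρ (x i)) s := by
    intro x s
    simp [SS, GG, map_sum, map_mul, map_pow, map_neg]
  set C : Set (Module.End L V) := ρ '' B with hC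
  have hPI' : ∀ x : ℕ → Module.End L V, (∀ i ∈ Finset.range Q, x i ∈ C) →
      SS x (Finset.range Q) = 0 := by
    intro x hx
    have : ∀ i, ∃ b ∈ B, i ∈ Finset.range Q → ρ b = x i := by
      intro i
      by_cases hi : i ∈ Finset.range Q
      · obtain ⟨b, hb, h⟩ := hx i hi
        exact ⟨b, hb, fun _ => h⟩
      · exact ⟨0, B.zero_mem, fun h => absurd h hi⟩
    choose b hb hbx using this
    rw [← SS_congr (x := fun i => ρ (b i)) hbx, ← hmap, hPI b hb, map_zero]
  have hspan := SS_span (L := L) C (Finset.range Q) hPI'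
  have hdens := rep_density ρ hV hs hcent
  have hideal : ∀ s ∈ Algebra.adjoin L (Set.range ρ), ∀ z ∈ Submodule.span L C,
      s * z ∈ Submodule.span L C ∧ z * s ∈ Submodule.span L C := by
    intro s hs
    induction hs using Algebra.adjoin_induction with
    | mem x hx =>
      obtain ⟨r, rfl⟩ := hx
      intro z hz
      induction hz using Submodule.span_induction with
      | mem z hz =>
        obtain ⟨b, hb, rfl⟩ := hz
        rw [← map_mul, ← map_mul]
        exact ⟨Submodule.subset_span ⟨_, B.mul_mem_left _ hb, rfl⟩,
          Submodule.subset_span ⟨_, B.mul_mem_right _ hb, rfl⟩⟩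
      | zero => simp
      | add a b _ _ ha hb =>
        rw [mul_add, add_mul]
        exact ⟨Submodule.add_mem _ ha.1 hb.1, Submodule.add_mem _ ha.2 hb.2⟩
      | smul c a _ ha =>
        rw [mul_smul_comm, smul_mul_assoc]
        exact ⟨Submodule.smul_mem _ _ ha.1, Submodule.smul_mem _ _ ha.2⟩
    | algebraMap l =>
      intro z hz
      rw [← Algebra.commutes, ← Algebra.smul_def]
      exact ⟨Submodule.smul_mem _ _ hz, Submodule.smul_mem _ _ hz⟩
    | add a b _ _ ha hb =>
      intro z hz
      rw [mul_add, add_mul]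
      exact ⟨Submodule.add_mem _ (ha z hz).1 (hb z hz).1,
        Submodule.add_mem _ (ha z hz).2 (hb z hz).2⟩
    | mul a b _ _ ha hb =>
      intro z hz
      rw [mul_assoc, ← mul_assoc z]
      exact ⟨(ha _ (hb z hz).1).1, (hb _ (ha z hz).2).2⟩
  obtain ⟨u, hu⟩ : ∃ u, ρ y u ≠ 0 := by
    by_contra! h
    exact hy0 (LinearMap.ext h)
  have hnoli : ∀ w : Fin (Q + 1) → V, ¬ LinearIndependent L w := by
    intro w hw
    have hx : ∀ i : ℕ, ∃ x ∈ Submodule.span L C, ∀ (h : i < Q),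
        x (w ⟨i, by omega⟩) = w ⟨i + 1, by omega⟩ ∧
          ∀ j : Fin (Q + 1), j.1 ≠ i → x (w j) = 0 := by
      intro i
      by_cases h : i < Q
      swap
      · exact ⟨0, Submodule.zero_mem _, fun h' => absurd h' h⟩
      obtain ⟨f1, hf1⟩ := exists_linearMap_of_li hw (fun j => if j.1 = i then u else 0)
      obtain ⟨f2, hf2⟩ := exists_linearMap_of_li (w := fun _ : Fin 1 => ρ y u)
        (LinearIndependent.of_subsingleton (R := L) (0 : Fin 1) hu) (fun _ => w ⟨i + 1, by omega⟩)
      classical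
      obtain ⟨s1, hs1, h1⟩ := hdens f1 (Finset.image w Finset.univ)
      obtain ⟨s2, hs2, h2⟩ := hdens f2 {ρ y u}
      have h1' : ∀ j, s1 (w j) = if j.1 = i then u else 0 := by
        intro j; rw [← hf1 j]; exact (h1 _ (by simp)).symm
      have h2' : s2 (ρ y u) = w ⟨i + 1, by omega⟩ := by
        rw [← hf2 0]; exact (h2 _ (by simp)).symm
      refine ⟨s2 * (ρ y * s1), (hideal s2 hs2 _ (hideal s1 hs1 _
        (Submodule.subset_span ⟨y, hy, rfl⟩)).2).1, fun _ => ⟨?_, fun j hj => ?_⟩⟩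
      · simp only [Module.End.mul_apply, h1', if_true, h2']
      · simp only [Module.End.mul_apply, h1', if_neg hj, map_zero]
    choose x hxC hx using hx
    let w' : ℕ → V := fun i => if h : i < Q + 1 then w ⟨i, h⟩ else 0
    have hw' : ∀ i (h : i < Q + 1), w' i = w ⟨i, h⟩ := fun i h => dif_pos h
    have := SS_shift x w' Q
      (fun i hi => by rw [hw' i (by omega), hw' (i+1) (by omega)]; exact (hx i hi).1)
      (fun i hi j hj hji => by rw [hw' j (by omega)]; exact (hx i hi).2 ⟨j, _⟩ hji)
      Q (Finset.range Q) (by simp) (by simp)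
    rw [hspan x (fun i _ => hxC i), if_pos rfl, hw' Q (by omega)] at this
    exact hw.ne_zero _ this.symm
  have hrank : Module.rank L V ≤ Q := by
    apply rank_le
    intro s hs
    by_contra hcard
    push Not at hcard
    obtain ⟨t, hts, htc⟩ := Finset.exists_subset_card_eq (show Q + 1 ≤ s.card by omega)
    have hli : LinearIndependent L (fun i : t => (i : V)) :=
      hs.comp (fun i : t => (⟨i.1, hts i.2⟩ : s)) (fun a b h => by
        have h2 := congrArg Subtype.val h
        exact Subtype.ext h2)
    exact hnoli _ (hli.comp _ ((t.equivFinOfCardEq htc).symm.injective))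
  have hfin : Module.Finite L V := by
    rw [← Module.rank_lt_aleph0_iff]
    exact lt_of_le_of_lt hrank (Cardinal.natCast_lt_aleph0)
  have hfr : Module.finrank L V ≤ Q := by
    rw [← Module.finrank_eq_rank] at hrank
    exact_mod_cast hrank
  refine ⟨Module.finrank L V, Module.finrank_pos, hfr,
    LinearMap.toMatrixAlgEquiv (Module.finBasis L V), ?_⟩
  have htop : ∀ f : Module.End L V, f ∈ Submodule.span L (Set.range ρ) := by
    intro f
    classical
    obtain ⟨t, ht, htf⟩ := hdens f (Finset.image (Module.finBasis L V) Finset.univ)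
    have hft : f = t := (Module.finBasis L V).ext fun i => htf _ (by simp)
    rw [hft]
    have h1 : (t : Module.End L V) ∈ Subalgebra.toSubmodule (Algebra.adjoin L (Set.range ρ)) := ht
    rw [Algebra.adjoin_eq_span] at h1
    have h2 : (Submonoid.closure (Set.range ρ) : Set (Module.End L V)) = Set.range ρ := by
      have : Set.range ρ = (MonoidHom.mrange (ρ : R →* Module.End L V) : Set _) := by
        ext z; simp
      rw [this, Submonoid.closure_eq]
    rwa [h2] at h1
  rw [eq_top_iff]
  rintro z -
  have hz := htop ((LinearMap.toMatrixAlgEquiv (Module.finBasis L V)).symm z)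
  have h3 := Submodule.mem_map_of_mem
    (f := (LinearMap.toMatrixAlgEquiv (Module.finBasis L V)).toLinearMap) hz
  rw [Submodule.map_span, ← Set.range_comp] at h3
  simpa using! h3

end PartRep3

section PartRep4
universe u

theorem exists_rep_aux1 {R L V : Type*} [Ring R] [Field L] [AddCommGroup V] [Module L V]
    [Module R V] [IsSimpleModule R V] (hLR : ∀ (r : R) (l : L) (x : V), r • l • x = l • r • x)
    (hcent : ∀ f : Module.End R V, (∀ (l : L) x, f (l • x) = l • f x) → ∃ l : L, ∀ x, f x = l • x)
    (B : Ideal R) (hB : B.IsTwoSided) (Q : ℕ)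
    (hPI : ∀ x : ℕ → R, (∀ i, x i ∈ B) → SS x (Finset.range Q) = 0)
    {y : R} (hy : y ∈ B) (hyV : ∃ u : V, y • u ≠ 0) :
    ∃ n, 0 < n ∧ n ≤ Q ∧ ∃ (ρ : R →+* Matrix (Fin n) (Fin n) L),
      Submodule.span L (Set.range ρ) = ⊤ ∧ ρ y ≠ 0 := by
  have hnt : Nontrivial V := IsSimpleModule.nontrivial R _
  obtain ⟨ρ, hρ⟩ : ∃ ρ : R →+* Module.End L V, ∀ r x, ρ r x = r • x := ⟨
    { toFun := fun r =>
        { toFun := fun x => r • x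
          map_add' := fun a b => smul_add r a b
          map_smul' := fun l x => hLR r l x }
      map_one' := by ext x; simp
      map_mul' := fun a b => by ext x; simp [mul_smul]
      map_zero' := by ext x; simp
      map_add' := fun a b => by ext x; simp [add_smul] }, fun r x => rfl⟩
  have hρy : ρ y ≠ 0 := by
    intro h0
    obtain ⟨u, hu⟩ := hyV
    apply hu
    rw [← hρ, h0, LinearMap.zero_apply]
  obtain ⟨n, hn, hnQ, e, he⟩ := rep_core ρ hnt (fun N hN => by
      let N' : Submodule R V := { N with smul_mem' := fun r x hx => by rw [← hρ]; exact hN r x hx }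
      rcases eq_bot_or_eq_top N' with h | h
      · left
        have : N'.toAddSubgroup = ⊥ := by rw [h]; rfl
        exact this
      · right
        have : N'.toAddSubgroup = ⊤ := by rw [h]; rfl
        exact this)
    (fun f hf1 hf2 => hcent { f with map_smul' := fun r x => (congrArg f (hρ r x)).symm.trans ((hf1 r x).trans (hρ r (f x))) } hf2) B hB Q hPI hy hρy
  obtain ⟨ρ', hρ'⟩ : ∃ ρ' : R →+* Matrix (Fin n) (Fin n) L, ∀ r, ρ' r = e (ρ r) :=
    ⟨(RingHomClass.toRingHom e).comp ρ, fun r => by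
      rw [RingHom.comp_apply]; rfl⟩
  have hfun : (fun r => e (ρ r)) = ρ' := funext fun r => (hρ' r).symm
  rw [hfun] at he
  refine ⟨n, hn, hnQ, ρ', he, fun h => ?_⟩
  rw [hρ'] at h
  apply hρy
  apply e.injective
  rw [map_zero]
  exact h

theorem exists_rep_aux2 {R L V : Type*} [Ring R] [Field L] [AddCommGroup V]
    [Module R V] [IsSimpleModule R V] (φ : L →+* Module.End R V)
    (hcent : ∀ f : Module.End R V, (∀ l : L, f * φ l = φ l * f) → ∃ l : L, f = φ l)
    (B : Ideal R) (hB : B.IsTwoSided) (Q : ℕ)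
    (hPI : ∀ x : ℕ → R, (∀ i, x i ∈ B) → SS x (Finset.range Q) = 0)
    {y : R} (hy : y ∈ B) (hyV : ∃ u : V, y • u ≠ 0) :
    ∃ n, 0 < n ∧ n ≤ Q ∧ ∃ (ρ : R →+* Matrix (Fin n) (Fin n) L),
      Submodule.span L (Set.range ρ) = ⊤ ∧ ρ y ≠ 0 := by
  let _ : Module L V := Module.compHom V φ
  have hact : ∀ (l : L) (x : V), l • x = φ l x := fun l x => rfl
  refine exists_rep_aux1 (L := L) (V := V) ?_ ?_ B hB Q hPI hy hyV
  · intro r l x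
    rw [hact, hact, map_smul]
  · intro f hf
    obtain ⟨l, hl⟩ := hcent f (fun l => LinearMap.ext fun x => hf l x)
    exact ⟨l, fun x => by rw [hl, hact]⟩

theorem exists_rep_of_maximal {R : Type u} [Ring R] (B : Ideal R) (hB : B.IsTwoSided) (Q : ℕ)
    (hPI : ∀ x : ℕ → R, (∀ i, x i ∈ B) → SS x (Finset.range Q) = 0)
    {y : R} (hy : y ∈ B) (I : Ideal R) (hI : IsCoatom I) (hyI : y ∉ I) :
    ∃ n, 0 < n ∧ n ≤ Q ∧ ∃ (L : Type u) (_ : Field L) (ρ : R →+* Matrix (Fin n) (Fin n) L),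
      Submodule.span L (Set.range ρ) = ⊤ ∧ ρ y ≠ 0 := by
  classical
  have hsimp : IsSimpleModule R (R ⧸ I) := isSimpleModule_iff_isCoatom.2 hI
  obtain ⟨L, hL1, hL2⟩ := exists_max_comm (Module.End R (R ⧸ I))
  let iL : Field L := { (inferInstance : DivisionRing L) with
    mul_comm := fun a b => Subtype.ext (hL1 a a.2 b b.2) }
  have hyV : ∃ u : R ⧸ I, y • u ≠ 0 := by
    refine ⟨Submodule.Quotient.mk 1, fun h1 => ?_⟩
    rw [← Submodule.Quotient.mk_smul] at h1
    have h2 := (Submodule.Quotient.mk_eq_zero I).1 h1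
    simp only [smul_eq_mul, mul_one] at h2
    exact hyI h2
  obtain ⟨n, hn, hnQ, ρ, h1, h2⟩ := exists_rep_aux2 (L := L) (V := R ⧸ I) L.subtype
    (fun f hf => ⟨⟨f, hL2 f fun l hl => hf ⟨l, hl⟩⟩, rfl⟩) B hB Q hPI hy hyV
  exact ⟨n, hn, hnQ, L, iL, ρ, h1, h2⟩

theorem Crit.exists_rep {κ : Type*} {R : Type u} [Field κ] [Ring R] [Algebra κ R]
    {B : Ideal R} {Q : ℕ} {v : R} (h : Crit κ B Q v) {y : R} (hy : y ∈ B) (hy0 : y ≠ 0) :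
    ∃ n, 0 < n ∧ n ≤ Q ∧ ∃ (L : Type u) (_ : Field L) (ρ : R →+* Matrix (Fin n) (Fin n) L),
      Submodule.span L (Set.range ρ) = ⊤ ∧ ρ y ≠ 0 := by
  have hJ : y ∉ Ring.jacobson R := fun hJ => hy0 (h.jacobson hy hJ)
  have : ∃ I : Ideal R, IsCoatom I ∧ y ∉ I := by
    by_contra! hc
    apply hJ
    rw [Ring.jacobson, Module.jacobson, Submodule.mem_sInf]
    exact fun I hI => hc I hI
  obtain ⟨I, hI, hyI⟩ := this
  exact exists_rep_of_maximal B h.two Q (fun x hx => h.PI hx) hy I hI hyI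

end PartRep4

section PartCap
variable {R : Type*} [Ring R] {m : ℕ}

/-- the word `x_{σ 0} y_0 x_{σ 1} y_1 ...` -/
def lst (x y : Fin m → R) (σ : Equiv.Perm (Fin m)) : List R := List.ofFn fun i => x (σ i) * y i

/-- Capelli polynomial -/
def Cap (x y : Fin m → R) : R := ∑ σ : Equiv.Perm (Fin m), Equiv.Perm.sign σ • (lst x y σ).prod

/-- the Razmyslov central polynomial -/
def cc (x y : Fin m → R) (b w : R) : R :=
  ∑ σ : Equiv.Perm (Fin m), ∑ j : Fin m, Equiv.Perm.sign σ •
    (x (σ j) * b * y j * ((lst x y σ).drop (j + 1)).prod * w * ((lst x y σ).take j).prod)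

theorem lst_map {S : Type*} [Ring S] (ρ : R →+* S) (x y : Fin m → R) (σ : Equiv.Perm (Fin m)) :
    (lst x y σ).map ρ = lst (fun i => ρ (x i)) (fun i => ρ (y i)) σ := by
  simp [lst, List.map_ofFn, Function.comp_def]

theorem cc_map {S : Type*} [Ring S] (ρ : R →+* S) (x y : Fin m → R) (b w : R) :
    ρ (cc x y b w) = cc (fun i => ρ (x i)) (fun i => ρ (y i)) (ρ b) (ρ w) := by
  simp only [cc, map_sum, Units.smul_def, map_zsmul, map_mul, map_list_prod, ← lst_map,
    List.map_drop, List.map_take]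

theorem Cap_map {S : Type*} [Ring S] (ρ : R →+* S) (x y : Fin m → R) :
    ρ (Cap x y) = Cap (fun i => ρ (x i)) (fun i => ρ (y i)) := by
  simp only [Cap, map_sum, Units.smul_def, map_zsmul, map_list_prod, ← lst_map]

theorem cc_mem (K : Ideal R) (hK : K.IsTwoSided) (x y : Fin m → R) (b w : R) (hw : w ∈ K) :
    cc x y b w ∈ K := by
  refine K.sum_mem fun σ _ => K.sum_mem fun j _ => ?_
  rw [Units.smul_def]
  refine zsmul_mem (K.mul_mem_right _ (K.mul_mem_left _ hw)) _

theorem lst_update (x y : Fin m → R) (σ : Equiv.Perm (Fin m)) (j : Fin m) (z : R) :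
    lst (Function.update x (σ j) z) y σ = (lst x y σ).set j (z * y j) := by
  apply List.ext_getElem
  · simp [lst]
  · intro i h1 h2
    simp only [lst, List.getElem_ofFn, List.getElem_set]
    split_ifs with h
    · have h3 : (⟨i, by simpa [lst] using h1⟩ : Fin m) = j := Fin.ext h.symm
      rw [h3]
      simp
    · rw [Function.update_of_ne]
      intro h'
      exact h (congrArg Fin.val (σ.injective h')).symm

theorem lst_update_prod (x y : Fin m → R) (σ : Equiv.Perm (Fin m)) (j : Fin m) (z : R) :
    (lst (Function.update x (σ j) z) y σ).prod =
      ((lst x y σ).take j).prod * (z * y j) * ((lst x y σ).drop (j + 1)).prod := by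
  rw [lst_update, List.prod_set, if_pos]
  simp [lst]

end PartCap

section PartCap2
variable {L : Type*} [Field L] {n m : ℕ}


theorem trace_cc (x y : Fin m → (Matrix (Fin n) (Fin n) L)) (a b w : (Matrix (Fin n) (Fin n) L)) :
    Matrix.trace (a * cc x y b w) =
      Matrix.trace ((∑ i, Cap (Function.update x i (a * x i * b)) y) * w) := by
  have h1 : (∑ i, Cap (Function.update x i (a * x i * b)) y) =
      ∑ σ : Equiv.Perm (Fin m), ∑ j : Fin m, Equiv.Perm.sign σ •
        (((lst x y σ).take j).prod * ((a * x (σ j) * b) * y j) *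
          ((lst x y σ).drop (j + 1)).prod) := by
    simp only [Cap]
    rw [Finset.sum_comm]
    refine Finset.sum_congr rfl fun σ _ => ?_
    rw [← Equiv.sum_comp σ]
    refine Finset.sum_congr rfl fun j _ => ?_
    rw [lst_update_prod]
  rw [h1, cc]
  simp only [Finset.mul_sum, Finset.sum_mul, Matrix.trace_sum]
  refine Finset.sum_congr rfl fun σ _ => Finset.sum_congr rfl fun j _ => ?_
  rw [mul_smul_comm, smul_mul_assoc, Units.smul_def, Matrix.trace_smul, Matrix.trace_smul]
  congr 1
  rw [← Matrix.mul_assoc, Matrix.trace_mul_comm]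
  simp only [Matrix.mul_assoc]

/-- Capelli polynomial as an alternating map -/
noncomputable def CapAlt (y : Fin m → (Matrix (Fin n) (Fin n) L)) : (Matrix (Fin n) (Fin n) L) [⋀^Fin m]→ₗ[L] (Matrix (Fin n) (Fin n) L) :=
  MultilinearMap.alternatization
    ((MultilinearMap.mkPiAlgebraFin L m (Matrix (Fin n) (Fin n) L)).compLinearMap fun i => LinearMap.mulRight L (y i))

theorem CapAlt_apply (x y : Fin m → (Matrix (Fin n) (Fin n) L)) : CapAlt y x = Cap x y := by
  rw [CapAlt, MultilinearMap.alternatization_apply]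
  rfl

/-- Capelli polynomial as a multilinear map in the second group of variables. -/
noncomputable def CapMul (x : Fin m → (Matrix (Fin n) (Fin n) L)) : MultilinearMap L (fun _ : Fin m => (Matrix (Fin n) (Fin n) L)) (Matrix (Fin n) (Fin n) L) :=
  ∑ σ : Equiv.Perm (Fin m), Equiv.Perm.sign σ •
    ((MultilinearMap.mkPiAlgebraFin L m (Matrix (Fin n) (Fin n) L)).compLinearMap fun i => LinearMap.mulLeft L (x (σ i)))

theorem CapMul_apply (x y : Fin m → (Matrix (Fin n) (Fin n) L)) : CapMul x y = Cap x y := by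
  rw [CapMul, sum_apply]
  rfl

theorem cc_zero_of_lt (hm : n ^ 2 < m) (x y : Fin m → (Matrix (Fin n) (Fin n) L)) (b w : (Matrix (Fin n) (Fin n) L)) : cc x y b w = 0 := by
  have hC : ∀ x, Cap x y = 0 := by
    intro x
    rw [← CapAlt_apply]
    apply AlternatingMap.map_linearDependent
    intro hli
    have := hli.fintype_card_le_finrank
    rw [Module.finrank_matrix] at this
    simp at this
    nlinarith
  rw [Matrix.ext_iff_trace_mul_left]
  intro a
  rw [trace_cc]
  simp [hC]

theorem trace_sandwich (a b : (Matrix (Fin n) (Fin n) L)) :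
    LinearMap.trace L (Matrix (Fin n) (Fin n) L) (LinearMap.mulLeft L a ∘ₗ LinearMap.mulRight L b) =
      Matrix.trace a * Matrix.trace b := by
  rw [LinearMap.trace_eq_matrix_trace L (Matrix.stdBasis L (Fin n) (Fin n)), Matrix.trace,
    Fintype.sum_prod_type, Matrix.trace, Matrix.trace, Finset.sum_mul_sum]
  refine Finset.sum_congr rfl fun i _ => Finset.sum_congr rfl fun j _ => ?_
  rw [Matrix.diag_apply, LinearMap.toMatrix_apply]
  rw [Matrix.stdBasis_eq_single]
  have h1 : ∀ M : (Matrix (Fin n) (Fin n) L), (Matrix.stdBasis L (Fin n) (Fin n)).repr M (i, j) = M i j := fun _ => rfl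
  rw [h1]
  simp only [LinearMap.comp_apply, LinearMap.mulLeft_apply, LinearMap.mulRight_apply]
  rw [← Matrix.mul_assoc, Matrix.mul_apply, Finset.sum_eq_single j]
  · simp
  · intro t _ ht
    rw [Matrix.mul_single_apply_of_ne _ _ _ _ _ ht, zero_mul]
  · simp

theorem alt_trace {M : Type*} [AddCommGroup M] [Module L M] (e : Module.Basis (Fin m) L M)
    (φ : M [⋀^Fin m]→ₗ[L] L) (T : M →ₗ[L] M) (x : Fin m → M) :
    ∑ i, φ (Function.update x i (T (x i))) = LinearMap.trace L M T * φ x := by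
  rw [AlternatingMap.eq_smul_basis_det e φ]
  simp only [AlternatingMap.smul_apply, smul_eq_mul, ← Finset.mul_sum, Module.Basis.det_apply,
    Module.Basis.toMatrix_update]
  set X := e.toMatrix x with hX
  set A := LinearMap.toMatrix e e T with hA
  have h1 : ∀ i, (X.updateCol i (e.repr (T (x i)))).det = (X.adjugate * (A * X)) i i := by
    intro i
    have : (e.repr (T (x i)) : Fin m → L) = fun j => (A * X) j i := by
      have h2 := LinearMap.toMatrix_mulVec_repr e e T (x i)
      rw [← h2]
      ext j
      simp [Matrix.mulVec, Matrix.mul_apply, dotProduct, hX, hA, Module.Basis.toMatrix_apply]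
    rw [← Matrix.cramer_apply, Matrix.cramer_eq_adjugate_mulVec, this]
    simp [Matrix.mulVec, Matrix.mul_apply, dotProduct]
  simp only [h1]
  have h3 : ∑ i, (X.adjugate * (A * X)) i i = Matrix.trace (X.adjugate * (A * X)) := rfl
  rw [h3, Matrix.trace_mul_comm, Matrix.mul_assoc, Matrix.mul_adjugate,
    LinearMap.trace_eq_matrix_trace L e, ← hA]
  simp
  ring

theorem cc_scalar (hm : m = n ^ 2) (x y : Fin m → (Matrix (Fin n) (Fin n) L)) (b w : (Matrix (Fin n) (Fin n) L)) :
    cc x y b w = (Matrix.trace b * Matrix.trace (Cap x y * w)) • (1 : (Matrix (Fin n) (Fin n) L)) := by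
  let e0 : Module.Basis (Fin n × Fin n) L (Matrix (Fin n) (Fin n) L) := Matrix.stdBasis L (Fin n) (Fin n)
  let e : Module.Basis (Fin m) L (Matrix (Fin n) (Fin n) L) := e0.reindex
    (finProdFinEquiv.trans (finCongr (by rw [hm, pow_two])))
  let φ : (Matrix (Fin n) (Fin n) L) [⋀^Fin m]→ₗ[L] L :=
    ((Matrix.traceLinearMap (Fin n) L L) ∘ₗ (LinearMap.mulRight L w)).compAlternatingMap (CapAlt y)
  have hφ : ∀ x, φ x = Matrix.trace (Cap x y * w) := by
    intro x
    rw [← CapAlt_apply]; rfl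
  rw [Matrix.ext_iff_trace_mul_left]
  intro a
  rw [trace_cc]
  have h := alt_trace e φ (LinearMap.mulLeft L a ∘ₗ LinearMap.mulRight L b) x
  rw [trace_sandwich] at h
  simp only [hφ] at h
  rw [Finset.sum_mul, Matrix.trace_sum]
  have h2 : ∀ i, Matrix.trace (Cap (Function.update x i (a * x i * b)) y * w) =
    Matrix.trace (Cap (Function.update x i ((LinearMap.mulLeft L a ∘ₗ LinearMap.mulRight L b) (x i))) y * w) := by
    intro i
    simp [Matrix.mul_assoc]
  simp only [h2]
  rw [h]
  simp [Matrix.trace_smul]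
  ring

end PartCap2

section PartNV
universe u

theorem chain_of_prod_ne_zero {S : Type*} [Ring S] : ∀ l : List S, l.prod ≠ 0 →
    l.IsChain (fun a b => a * b ≠ 0)
  | [], _ => by simp
  | [a], _ => by simp
  | a :: b :: l, h => by
    rw [List.isChain_cons_cons]
    constructor
    · intro h0
      apply h
      rw [List.prod_cons, List.prod_cons, ← mul_assoc, h0, zero_mul]
    · apply chain_of_prod_ne_zero
      intro h0
      apply h
      rw [List.prod_cons, h0, mul_zero]

variable {L : Type u} [Field L] {n m : ℕ}

theorem prod_single (m : ℕ) : ∀ a : ℕ → Fin n,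
    (List.ofFn fun i : Fin (m + 1) =>
      (Matrix.single (a i) (a (i + 1)) 1 : Matrix (Fin n) (Fin n) L)).prod =
      Matrix.single (a 0) (a (m + 1)) 1 := by
  induction m with
  | zero => intro a; simp
  | succ m ih =>
    intro a
    rw [List.ofFn_succ, List.prod_cons]
    have := ih (fun i => a (i + 1))
    simp only [Fin.val_succ, Fin.val_zero] at this ⊢
    rw [this]
    simp

theorem exists_Cap_ne_zero (hn : 0 < n) (hm : m = n ^ 2) :
    ∃ x y : Fin m → Matrix (Fin n) (Fin n) L, Cap x y ≠ 0 := by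
  let e : Fin m ≃ Fin n × Fin n := (finCongr (by rw [hm, pow_two])).trans finProdFinEquiv.symm
  let a : ℕ → Fin n := fun i => if h : i < m then (e ⟨i, h⟩).1 else ⟨0, hn⟩
  have ha : ∀ i : Fin m, a i = (e i).1 := by
    intro i
    simp [a]
  let x : Fin m → Matrix (Fin n) (Fin n) L := fun i => Matrix.single (e i).1 (e i).2 1
  let y : Fin m → Matrix (Fin n) (Fin n) L := fun i => Matrix.single (e i).2 (a (i + 1)) 1
  refine ⟨x, y, ?_⟩
  have key : ∀ σ : Equiv.Perm (Fin m), (lst x y σ).prod ≠ 0 → σ = 1 := by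
    intro σ hσ
    have hb : ∀ i, (e (σ i)).2 = (e i).2 := by
      intro i
      by_contra hne
      apply hσ
      apply List.prod_eq_zero
      rw [lst, List.mem_ofFn]
      exact ⟨i, by simp [x, y, hne]⟩
    have hch := chain_of_prod_ne_zero _ hσ
    rw [List.isChain_iff_getElem] at hch
    have hpos : ∀ i : Fin m, 0 < (i : ℕ) → σ i = i := by
      rintro ⟨i, hi⟩ h0
      obtain ⟨j, rfl⟩ : ∃ j, i = j + 1 := ⟨i - 1, by simp at h0; omega⟩
      have h1 := hch j (by simpa [lst] using hi)
      simp only [lst, List.getElem_ofFn, x, y, hb] at h1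
      have ha' := ha ⟨j + 1, hi⟩
      simp only at ha'
      apply e.injective
      apply Prod.ext _ (hb _)
      by_contra hne
      apply h1
      rw [ha', Matrix.single_mul_single_same, Matrix.single_mul_single_same,
        Matrix.single_mul_single_of_ne]
      exact fun h => hne h.symm
    ext i
    rcases Nat.eq_zero_or_pos (i : ℕ) with h0 | h0
    · by_contra hne
      have h2 := hpos (σ i) (by
        rcases Nat.eq_zero_or_pos (σ i : ℕ) with h3 | h3
        · exact absurd (h3.trans h0.symm) hne
        · exact h3)
      exact hne (congrArg Fin.val (σ.injective h2))
    · rw [hpos i h0]; rfl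
  rw [Cap, Finset.sum_eq_single 1]
  · rw [Equiv.Perm.sign_one, one_smul, lst]
    obtain ⟨m', hm'⟩ : ∃ m', m = m' + 1 := ⟨m - 1, by
      have : 0 < m := by rw [hm]; positivity
      omega⟩
    have h2 : (fun i : Fin m => x ((1 : Equiv.Perm (Fin m)) i) * y i) =
        fun i : Fin m => Matrix.single (a i) (a (i + 1)) 1 := by
      funext i
      rw [ha]
      simp [x, y]
    rw [h2]
    clear_value a
    clear h2 key x y ha e
    subst hm'
    rw [prod_single]
    intro h
    have := congrFun (congrFun h (a 0)) (a (m' + 1))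
    simp at this
  · intro σ _ hσ
    by_contra h
    apply hσ
    apply key
    intro h0
    exact h (by rw [h0, smul_zero])
  · simp

variable {R : Type*} [Ring R]

theorem exists_Cap_rep (ρ : R →+* Matrix (Fin n) (Fin n) L)
    (hρ : Submodule.span L (Set.range ρ) = ⊤) (hn : 0 < n) (hm : m = n ^ 2) :
    ∃ x y : Fin m → R, Cap (fun i => ρ (x i)) (fun i => ρ (y i)) ≠ 0 := by
  by_contra! hc
  obtain ⟨x0, y0, h0⟩ := exists_Cap_ne_zero (L := L) hn hm
  have h1 : ∀ x : Fin m → R, CapMul (fun i => ρ (x i)) = 0 := by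
    intro x
    refine MultilinearMap.ext_of_span_eq_top (g := fun _ => ρ) (fun i => hρ) ?_
    intro j
    rw [CapMul_apply]
    exact hc x j
  have h2 : (CapAlt y0).toMultilinearMap = 0 := by
    refine MultilinearMap.ext_of_span_eq_top (g := fun _ => ρ) (fun i => hρ) ?_
    intro j
    change CapAlt y0 _ = 0
    rw [CapAlt_apply, ← CapMul_apply, h1]
    rfl
  apply h0
  rw [← CapAlt_apply]
  change (CapAlt y0).toMultilinearMap x0 = 0
  rw [h2]
  rfl

theorem exists_trace_ne_zero (ρ : R →+* Matrix (Fin n) (Fin n) L)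
    (hρ : Submodule.span L (Set.range ρ) = ⊤) (K : Ideal R) (hK : K.IsTwoSided)
    {w0 : R} (hw0 : w0 ∈ K) (hw : ρ w0 ≠ 0) {N : Matrix (Fin n) (Fin n) L} (hN : N ≠ 0) :
    ∃ w ∈ K, Matrix.trace (N * ρ w) ≠ 0 := by
  by_contra! hc
  have h1 : ∀ r, N * ρ r * ρ w0 = 0 := by
    intro r
    rw [Matrix.ext_iff_trace_mul_right]
    intro P
    have hP : P ∈ Submodule.span L (Set.range ρ) := by rw [hρ]; trivial
    induction hP using Submodule.span_induction with
    | mem p hp =>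
      obtain ⟨s, rfl⟩ := hp
      have := hc (r * w0 * s) (K.mul_mem_right _ (K.mul_mem_left _ hw0))
      rw [map_mul, map_mul] at this
      simpa [mul_assoc] using this
    | zero => simp
    | add p q _ _ h1 h2 => simp only [mul_add, Matrix.trace_add, h1, h2, zero_mul, Matrix.trace_zero, add_zero]
    | smul c p _ h => simp only [mul_smul_comm, Matrix.trace_smul, h, zero_mul, Matrix.trace_zero, smul_zero]
  have h2 : ∀ P, N * P * ρ w0 = 0 := by
    intro P
    have hP : P ∈ Submodule.span L (Set.range ρ) := by rw [hρ]; trivial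
    induction hP using Submodule.span_induction with
    | mem p hp =>
      obtain ⟨s, rfl⟩ := hp
      exact h1 s
    | zero => simp
    | add p q _ _ h1 h2 => simp [mul_add, add_mul, h1, h2]
    | smul c p _ h => simp [h]
  obtain ⟨i, j, hij⟩ : ∃ i j, N i j ≠ 0 := by
    by_contra! h
    exact hN (by ext i j; exact h i j)
  obtain ⟨s, l, hkl⟩ : ∃ s l, ρ w0 s l ≠ 0 := by
    by_contra! h
    exact hw (by ext i j; exact h i j)
  have h3 := congrFun (congrFun (h2 (Matrix.single j s 1)) i) l
  rw [Matrix.mul_apply, Finset.sum_eq_single s] at h3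
  · simp at h3
    tauto
  · intro t _ ht
    rw [Matrix.mul_single_apply_of_ne _ _ _ _ _ ht, zero_mul]
  · simp

/-- good representation predicate -/
def GoodRep {R : Type u} [Ring R] (K : Ideal R) (d : ℕ) : Prop :=
  0 < d ∧ ∃ (L : Type u) (_ : Field L) (ρ : R →+* Matrix (Fin d) (Fin d) L),
      Submodule.span L (Set.range ρ) = ⊤ ∧ ∃ w ∈ K, ρ w ≠ 0

theorem Crit.razmyslov {κ : Type*} {R : Type u} [Field κ] [Ring R] [Algebra κ R]
    {B : Ideal R} {Q : ℕ} {v : R} (h : Crit κ B Q v) (K : Ideal R) (hK : K.IsTwoSided)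
    (hKB : K ≤ B) (hK0 : K ≠ ⊥) :
    ∃ (d m : ℕ) (x y : Fin m → R) (w : R), 0 < d ∧ m = d ^ 2 ∧ w ∈ K ∧
      (∀ b r, cc x y b w * r = r * cc x y b w) ∧
      ∃ (L : Type u) (_ : Field L) (ρ : R →+* Matrix (Fin d) (Fin d) L) (γ : L),
        Submodule.span L (Set.range ρ) = ⊤ ∧ γ ≠ 0 ∧
        Cap (fun i => ρ (x i)) (fun i => ρ (y i)) ≠ 0 ∧
        ∀ b, ρ (cc x y b w) = (Matrix.trace (ρ b) * γ) • 1 := by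
  classical
  have hex : ∃ d ≤ Q, GoodRep K d := by
    obtain ⟨w, hw, hw0⟩ := K.exists_mem_ne_zero_of_ne_bot hK0
    obtain ⟨n, hn, hnQ, L, iL, ρ, h1, h2⟩ := h.exists_rep (hKB hw) hw0
    exact ⟨n, hnQ, hn, L, iL, ρ, h1, w, hw, h2⟩
  set d := Nat.findGreatest (GoodRep K) Q with hd
  have hgd : GoodRep K d := by
    obtain ⟨d0, hd0, hg⟩ := hex
    exact Nat.findGreatest_spec hd0 hg
  obtain ⟨hdpos, L, iL, ρ, hspan, w0, hw0, hw0'⟩ := hgd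
  obtain ⟨x, y, hxy⟩ := exists_Cap_rep (m := d ^ 2) ρ hspan hdpos rfl
  obtain ⟨w, hw, htr⟩ := exists_trace_ne_zero ρ hspan K hK hw0 hw0' hxy
  refine ⟨d, d ^ 2, x, y, w, hdpos, rfl, hw, ?_, L, iL, ρ, _, hspan, htr, hxy, ?_⟩
  · intro b r
    by_contra hne
    have hcK := cc_mem K hK x y b w hw
    have hcB : cc x y b w * r - r * cc x y b w ∈ B :=
      hKB (K.sub_mem (K.mul_mem_right _ hcK) (K.mul_mem_left _ hcK))
    obtain ⟨n, hn, hnQ, L', iL', ρ', h1, h2⟩ := h.exists_rep hcB (sub_ne_zero.2 hne)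
    apply h2
    rw [map_sub, map_mul, map_mul]
    rcases lt_trichotomy n d with hlt | heq | hgt
    · rw [cc_map, cc_zero_of_lt]
      · simp
      · exact Nat.pow_lt_pow_left hlt (by norm_num)
    · rw [cc_map, cc_scalar (by rw [heq])]
      simp
    · have hng : ¬ GoodRep K n := Nat.findGreatest_is_greatest hgt hnQ
      have h0 : ρ' (cc x y b w) = 0 := by
        by_contra h0
        exact hng ⟨hn, L', iL', ρ', h1, _, hcK, h0⟩
      rw [h0]; simp
  · intro b
    rw [cc_map, cc_scalar rfl]

end PartNV

section PartSimple
universe u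

theorem exists_trace_rep {R L : Type*} [Ring R] [Field L] {d : ℕ} (hd : 0 < d)
    (ρ : R →+* Matrix (Fin d) (Fin d) L)
    (hρ : Submodule.span L (Set.range ρ) = ⊤) : ∃ b, Matrix.trace (ρ b) ≠ 0 := by
  by_contra! hc
  have h2 : ∀ P : Matrix (Fin d) (Fin d) L, Matrix.trace P = 0 := by
    intro P
    have hP : P ∈ Submodule.span L (Set.range ρ) := by rw [hρ]; trivial
    induction hP using Submodule.span_induction with
    | mem p hp =>
      obtain ⟨s, rfl⟩ := hp
      exact hc s
    | zero => simp
    | add p q _ _ h1 h2 => simp [h1, h2]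
    | smul c p _ h => simp [h]
  have := h2 (Matrix.single ⟨0, hd⟩ ⟨0, hd⟩ 1)
  simp at this

variable {κ : Type*} {R : Type u} [Field κ] [Ring R] [Algebra κ R]
    {B : Ideal R} {Q : ℕ} {v : R}

theorem Crit.eq_top (h : Crit κ B Q v) (K : Ideal R) (hK : K.IsTwoSided)
    (hKB : K ≤ B) (hK0 : K ≠ ⊥) : K = ⊤ := by
  obtain ⟨d, m, x, y, w, hd, hm, hw, hcent, L, iL, ρ, γ, hspan, hγ, -, hcc⟩ :=
    h.razmyslov K hK hKB hK0
  obtain ⟨b, hb⟩ := exists_trace_rep hd ρ hspan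
  set c := cc x y b w with hc
  have hcK : c ∈ K := cc_mem K hK x y b w hw
  have hc0 : c ≠ 0 := by
    intro h0
    have h1 := hcc b
    rw [← hc, h0, map_zero] at h1
    have h2 := congrFun (congrFun h1 ⟨0, hd⟩) ⟨0, hd⟩
    simp at h2
    tauto
  have hcc' : ∀ r, c * r = r * c := hcent b
  have hcQ := h.central (hKB hcK) hcc'
  have hQ := h.frob.1
  have hQ2 : 4 ≤ Q ^ 2 := by nlinarith
  obtain ⟨N, hN⟩ : ∃ N, Q ^ 2 = N + 2 := ⟨Q ^ 2 - 2, by omega⟩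
  rw [hN] at hcQ
  set e := c ^ (N + 1) with he
  have hec : e * c = c := by rw [he, ← pow_succ, hcQ]
  have hee : e * e = e := by
    have : e = c * c ^ N := by rw [he, pow_succ']
    conv_lhs => rw [this, ← mul_assoc, ← this, hec]
    rw [this]
  have hecent : ∀ r, e * r = r * e := fun r => Commute.pow_left (hcc' r) _
  have heK : e ∈ K := Ideal.pow_mem_of_mem _ hcK _ (by omega)
  by_contra hne
  have he1 : 1 - e ≠ 0 := by
    intro h1
    apply hne
    rw [Ideal.eq_top_iff_one, sub_eq_zero.1 h1]
    exact heK
  have he0 : e ≠ 0 := by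
    intro h0
    rw [h0, zero_mul] at hec
    exact hc0 hec.symm
  have := h.two
  have ann : ∀ f : R, (∀ r, f * r = r * f) → ∀ g : R, g ≠ 0 → f * g = 0 →
      ∃ w ∈ WW κ B Q, f * (v - w) = 0 := by
    intro f hf g hg hfg
    let K1 : Ideal R :=
      { carrier := {r | f * r = 0}
        add_mem' := by
          intro a b ha hb
          simp only [Set.mem_ofPred_eq] at *
          rw [mul_add, ha, hb, add_zero]
        zero_mem' := by simp
        smul_mem' := by
          intro s a ha
          simp only [Set.mem_ofPred_eq, smul_eq_mul] at *
          rw [← mul_assoc, hf, mul_assoc, ha, mul_zero] }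
    have hK1 : K1.IsTwoSided := ⟨fun {a} b ha => by
      change f * (a * b) = 0
      have ha' : f * a = 0 := ha
      rw [← mul_assoc, ha', zero_mul]⟩
    obtain ⟨w, hw, hvw⟩ := h.max K1 hK1 (by
      intro hbot
      have : g ∈ K1 := hfg
      rw [hbot] at this
      exact hg (by simpa using this))
    exact ⟨w, hw, hvw⟩
  obtain ⟨w1, hw1, h1⟩ := ann e hecent (1 - e) he1 (by rw [mul_sub, mul_one, hee, sub_self])
  obtain ⟨w2, hw2, h2⟩ := ann (1 - e) (fun r => by rw [sub_mul, mul_sub, hecent]; simp) e he0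
    (by rw [sub_mul, one_mul, hee, sub_self])
  apply h.notMem
  have : v = e * w1 + (1 - e) * w2 := by
    have e1 : e * v = e * w1 := by rw [mul_sub] at h1; exact sub_eq_zero.1 h1
    have e2 : (1 - e) * v = (1 - e) * w2 := by rw [mul_sub] at h2; exact sub_eq_zero.1 h2
    rw [← e1, ← e2, ← add_mul]
    simp
  rw [this]
  exact Submodule.add_mem _ (WW_idem_mul hQ hee hecent hw1) (WW_mul_idem_sub hQ hee hecent hw2)

theorem Crit.B_top (h : Crit κ B Q v) (hv : v ∈ B) : B = ⊤ := by
  apply h.eq_top B h.two le_rfl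
  intro hB
  apply h.notMem
  rw [hB] at hv
  rw [show v = 0 by simpa using hv]
  exact Submodule.zero_mem _

theorem Crit.isSimpleRing (h : Crit κ B Q v) (hv : v ∈ B) : IsSimpleRing R := by
  have hB := h.B_top hv
  have := h.nontrivial
  refine ⟨⟨fun I => ?_⟩⟩
  by_cases hI : I.asIdeal = ⊥
  · left
    rw [← TwoSidedIdeal.bot_asIdeal] at hI
    rw [← Ideal.toTwoSided_asIdeal I, ← Ideal.toTwoSided_asIdeal (⊥ : TwoSidedIdeal R)]
    ext x
    rw [Ideal.mem_toTwoSided, Ideal.mem_toTwoSided, hI]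
  · right
    have hI := h.eq_top I.asIdeal inferInstance (by rw [hB]; exact le_top) hI
    rw [← TwoSidedIdeal.top_asIdeal] at hI
    rw [← Ideal.toTwoSided_asIdeal I, ← Ideal.toTwoSided_asIdeal (⊤ : TwoSidedIdeal R)]
    ext x
    rw [Ideal.mem_toTwoSided, Ideal.mem_toTwoSided, hI]

theorem Crit.finite_center (h : Crit κ B Q v) (hv : v ∈ B) : Finite (Subring.center R) := by
  have hs := h.isSimpleRing hv
  have hB := h.B_top hv
  letI : Field (Subring.center R) := (IsSimpleRing.isField_center R).toField
  have hQ := h.frob.1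
  have hQ2 : 4 ≤ Q ^ 2 := by nlinarith
  rw [← Set.finite_univ_iff]
  have hp : (Polynomial.X ^ (Q ^ 2) - Polynomial.X : Polynomial (Subring.center R)) ≠ 0 :=
    FiniteField.X_pow_card_sub_X_ne_zero _ (by omega)
  refine (Polynomial.finite_setOfPred_isRoot hp).subset ?_
  intro c _
  have hc : ∀ r, (c : R) * r = r * c := fun r => ((Subring.mem_center_iff.1 c.2) r).symm
  have h1 := h.central (c := (c : R)) (by rw [hB]; trivial) hc
  have h2 : c ^ (Q ^ 2) = c := Subtype.ext (by push_cast; exact h1)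
  simp [Polynomial.IsRoot, h2]

theorem Crit.finite (h : Crit κ B Q v) (hv : v ∈ B) : Finite R := by
  have hs := h.isSimpleRing hv
  have hB := h.B_top hv
  have hfc := h.finite_center hv
  have := h.nontrivial
  obtain ⟨d, m, x, y, w, hd, hm, hw, hcent, L, iL, ρ, γ, hspan, hγ, hCap, hcc⟩ :=
    h.razmyslov ⊤ inferInstance (by rw [hB]) (by simp)
  have hρinj : Function.Injective ρ := by
    have : Nontrivial (Matrix (Fin d) (Fin d) L) := by
      have : Nonempty (Fin d) := ⟨⟨0, hd⟩⟩
      infer_instance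
    exact RingHom.injective ρ
  have hli : LinearIndependent L (fun i => ρ (x i)) := by
    by_contra hli
    apply hCap
    rw [← CapAlt_apply]
    exact AlternatingMap.map_linearDependent _ _ hli
  have hsp := hli.span_eq_top_of_card_eq_finrank' (by
    rw [Module.finrank_matrix]
    simp [hm, pow_two])
  let f : R → (Fin m → Subring.center R) := fun b i =>
    ⟨cc x y (b * x i) w, Subring.mem_center_iff.2 fun r => (hcent _ r).symm⟩
  apply Finite.of_injective f
  intro b b' hbb
  apply hρinj
  rw [Matrix.ext_iff_trace_mul_right]
  intro P
  have hP : P ∈ Submodule.span L (Set.range (fun i => ρ (x i))) := by rw [hsp]; trivial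
  induction hP using Submodule.span_induction with
  | mem p hp =>
    obtain ⟨i, rfl⟩ := hp
    have h1 : cc x y (b * x i) w = cc x y (b' * x i) w :=
      congrArg Subtype.val (congrFun hbb i)
    have h2 := congrArg ρ h1
    rw [hcc, hcc] at h2
    have h3 := congrFun (congrFun h2 ⟨0, hd⟩) ⟨0, hd⟩
    simp at h3
    simpa [hγ] using h3
  | zero => simp
  | add p q _ _ h1 h2 => simp only [mul_add, Matrix.trace_add, h1, h2]
  | smul c p _ h => simp only [mul_smul_comm, Matrix.trace_smul, h]

end PartSimple

section PartMat

theorem frobProp_of_prime {R : Type*} [Ring R] {p j : ℕ} (hp : p.Prime) (h0 : (p : R) = 0)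
    (hj : 1 ≤ j) : FrobProp R (p ^ j) := by
  refine ⟨hp.two_le.trans (Nat.le_self_pow (by omega) p), fun a b hab => ?_⟩
  obtain ⟨r, hr⟩ := hab.exists_add_pow_prime_pow_eq hp j
  rw [hr, h0]
  simp

theorem WW_map {κ R S : Type*} [Field κ] [Ring R] [Algebra κ R] [Ring S] [Algebra κ S]
    (f : R →ₐ[κ] S) {B : Ideal R} {B' : Ideal S} (hB : ∀ y ∈ B, f y ∈ B') {Q : ℕ} {w : R}
    (hw : w ∈ WW κ B Q) : f w ∈ WW κ B' Q := by
  have : WW κ B Q ≤ (WW κ B' Q).comap f.toLinearMap := by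
    rw [WW, Submodule.span_le]
    rintro z ⟨y, hy, rfl | rfl⟩
    · change f (y + y ^ Q) ∈ WW κ B' Q
      rw [map_add, map_pow]
      exact WW_one (hB y hy)
    · change f (y ^ (Q + 1)) ∈ WW κ B' Q
      rw [map_pow]
      exact WW_two (hB y hy)
  exact this hw

theorem pow_Q_of_ext {F E : Type*} [Field F] [Finite F] [Field E] [Finite E] {p j : ℕ}
    (hp : p.Prime) [CharP F p]
    (hcard : Nat.card E = Nat.card F ^ 2) (hE : ∀ α : E, α ^ ((p ^ j) ^ 2) = α) (s : F) :
    s ^ (p ^ j) = s := by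
  have := Fintype.ofFinite F
  have := Fintype.ofFinite E
  have := Fact.mk hp
  obtain ⟨⟨i, hi⟩, -, hcF⟩ := FiniteField.card F p
  simp only [PNat.mk_coe] at hcF
  rw [Nat.card_eq_fintype_card, Nat.card_eq_fintype_card, hcF, ← pow_mul] at hcard
  have h1 : ∀ u : Eˣ, u ^ (p ^ (j * 2) - 1) = 1 := by
    intro u
    have h2 := hE u
    rw [← pow_mul] at h2
    have hpos : 0 < p ^ (j * 2) := pow_pos hp.pos _
    have h3 : u ^ (p ^ (j * 2) - 1) * u = 1 * u := by
      rw [← pow_succ, Nat.sub_add_cancel hpos, one_mul]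
      exact Units.ext (by push_cast; exact h2)
    exact mul_right_cancel h3
  rw [FiniteField.forall_pow_eq_one_iff, hcard] at h1
  have h2 := Nat.gcd_eq_left h1
  rw [Nat.pow_sub_one_gcd_pow_sub_one] at h2
  have h3 : p ^ (Nat.gcd (i * 2) (j * 2)) = p ^ (i * 2) := by
    have a1 : 0 < p ^ (Nat.gcd (i * 2) (j * 2)) := pow_pos hp.pos _
    have a2 : 0 < p ^ (i * 2) := pow_pos hp.pos _
    omega
  have h4 := Nat.pow_right_injective hp.two_le h3
  have h5 : i * 2 ∣ j * 2 := by rw [← h4]; exact Nat.gcd_dvd_right _ _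
  obtain ⟨t, rfl⟩ : i ∣ j := (Nat.mul_dvd_mul_iff_right (by norm_num)).1 h5
  rw [pow_mul, ← hcF, FiniteField.pow_card_pow]

variable {κ F : Type*} [Field κ] [Field F] [Algebra κ F] {r Q : ℕ}

theorem mat_sub_trace (hF : FrobProp (Matrix (Fin (r + 2)) (Fin (r + 2)) F) Q)
    (A : Matrix (Fin (r + 2)) (Fin (r + 2)) F) :
    A - Matrix.single 0 0 (Matrix.trace A) ∈ WW κ (⊤ : Ideal _) Q := by
  have N1 : ∀ (i j : Fin (r + 2)) (s : F), i ≠ j → Matrix.single i j s ∈ WW κ (⊤ : Ideal _) Q := by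
    intro i j s hij
    refine WW_of_isNilpotent hF trivial ⟨2, ?_⟩
    rw [pow_two, Matrix.single_mul_single_of_ne _ _ _ _ hij.symm]
  have N2 : ∀ (i j : Fin (r + 2)) (s : F), i ≠ j →
      Matrix.single i i s - Matrix.single j j s ∈ WW κ (⊤ : Ideal _) Q := by
    intro i j s hij
    have h1 : Matrix.single i i s + Matrix.single i j s - Matrix.single j i s
        - Matrix.single j j s ∈ WW κ (⊤ : Ideal _) Q := by
      refine WW_of_isNilpotent hF trivial ⟨2, ?_⟩
      rw [pow_two]
      simp only [mul_add, mul_sub, add_mul, sub_mul, Matrix.single_mul_single_same]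
      rw [Matrix.single_mul_single_of_ne _ _ _ _ hij, Matrix.single_mul_single_of_ne _ _ _ _ hij,
        Matrix.single_mul_single_of_ne _ _ _ _ hij, Matrix.single_mul_single_of_ne _ _ _ _ hij,
        Matrix.single_mul_single_of_ne _ _ _ _ hij.symm,
        Matrix.single_mul_single_of_ne _ _ _ _ hij.symm,
        Matrix.single_mul_single_of_ne _ _ _ _ hij.symm,
        Matrix.single_mul_single_of_ne _ _ _ _ hij.symm]
      abel
    have h2 := Submodule.add_mem _ (Submodule.sub_mem _ h1 (N1 i j s hij)) (N1 j i s hij.symm)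
    convert h2 using 1
    abel
  have h3 : A - Matrix.single 0 0 (Matrix.trace A) = ∑ i, ∑ j,
      (Matrix.single i j (A i j) - Matrix.single 0 0 (if i = j then A i j else 0)) := by
    simp only [Finset.sum_sub_distrib]
    rw [← Matrix.matrix_eq_sum_single A]
    congr 1
    have h4 : ∀ f : Fin (r + 2) → F, ∑ i, Matrix.single (0 : Fin (r + 2)) (0 : Fin (r + 2)) (f i) =
      Matrix.single 0 0 (∑ i, f i) := fun f =>
        (map_sum (Matrix.singleAddMonoidHom (0 : Fin (r + 2)) (0 : Fin (r + 2))) f _).symm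
    simp only [h4]
    congr 1
    simp [Matrix.trace]
  rw [h3]
  refine Submodule.sum_mem _ fun i _ => Submodule.sum_mem _ fun j _ => ?_
  by_cases hij : i = j
  · subst hij
    rw [if_pos rfl]
    by_cases hi : i = 0
    · subst hi; rw [sub_self]; exact Submodule.zero_mem _
    · exact N2 _ _ _ hi
  · rw [if_neg hij, Matrix.single_zero, sub_zero]
    exact N1 _ _ _ hij

theorem mat_mem [Finite F] {p j : ℕ} (hp : p.Prime) [CharP F p] (hj : 1 ≤ j)
    (A : Matrix (Fin (r + 2)) (Fin (r + 2)) F) : A ∈ WW κ (⊤ : Ideal _) (p ^ j) := by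
  have := Fact.mk hp
  have hF : FrobProp (Matrix (Fin (r + 2)) (Fin (r + 2)) F) (p ^ j) := by
    apply frobProp_of_prime hp _ hj
    exact CharP.cast_eq_zero _ _
  suffices hs : ∀ s : F, Matrix.single 0 0 s ∈
      WW κ (⊤ : Ideal (Matrix (Fin (r + 2)) (Fin (r + 2)) F)) (p ^ j) by
    have := Submodule.add_mem _ (mat_sub_trace (κ := κ) hF A) (hs (Matrix.trace A))
    simpa using this
  have hpow : ∀ (s : F) (m : ℕ), (Matrix.single 0 0 s : Matrix (Fin (r + 2)) (Fin (r + 2)) F) ^ (m + 1)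
      = Matrix.single 0 0 (s ^ (m + 1)) := by
    intro s m
    induction m with
    | zero => simp
    | succ m ih => rw [pow_succ, ih, Matrix.single_mul_single_same, ← pow_succ]
  have hQpos : 0 < p ^ j := pow_pos hp.pos _
  by_cases hQ : ∀ s : F, s ^ (p ^ j) = s
  · by_cases h2 : p = 2
    · intro s
      have hsq : IsSquare s := FiniteField.isSquare_of_char_two (by
        rw [← h2]; exact ringChar.eq F p) s
      obtain ⟨t, rfl⟩ := hsq
      have h1 := WW_two (κ := κ) (Q := p ^ j) (B := ⊤)
        (y := (Matrix.single 0 0 t : Matrix (Fin (r + 2)) (Fin (r + 2)) F)) trivial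
      rw [hpow, pow_succ, hQ] at h1
      exact h1
    · intro s
      have h20 : (2 : F) ≠ 0 := by
        have := CharP.cast_eq_zero_iff F p 2
        intro h
        have h3 := this.1 (by exact_mod_cast h)
        exact h2 ((Nat.prime_dvd_prime_iff_eq hp Nat.prime_two).1 h3)
      have : NeZero (2 : F) := ⟨h20⟩
      have h1 := WW_one (κ := κ) (Q := p ^ j) (B := ⊤)
        (y := (Matrix.single 0 0 (s / 2) : Matrix (Fin (r + 2)) (Fin (r + 2)) F)) trivial
      obtain ⟨m, hm⟩ : ∃ m, p ^ j = m + 1 := ⟨p ^ j - 1, by omega⟩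
      have h3 : (Matrix.single 0 0 (s / 2) : Matrix (Fin (r + 2)) (Fin (r + 2)) F) ^ (p ^ j)
        = Matrix.single 0 0 (s / 2) := by
        have h4 := hQ (s / 2)
        rw [hm] at h4 ⊢
        rw [hpow, h4]
      rw [h3, ← Matrix.single_add, add_halves] at h1
      exact h1
  · let E := FiniteField.Extension F p 2
    obtain ⟨α, hα⟩ : ∃ α : E, α ^ ((p ^ j) ^ 2) ≠ α := by
      by_contra! hc
      exact hQ fun s => pow_Q_of_ext hp (FiniteField.natCard_extension F p 2) hc s
    let b : Module.Basis (Fin 2) F E :=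
      Module.finBasisOfFinrankEq F E (FiniteField.finrank_extension F p 2)
    let f : Fin 2 → Fin (r + 2) := Fin.castLE (by omega)
    have hf : Function.Injective f := Fin.castLE_injective _
    let P : Matrix (Fin (r + 2)) (Fin 2) F := (1 : Matrix (Fin (r + 2)) (Fin (r + 2)) F).submatrix id f
    have hPP : P.transpose * P = 1 := by
      rw [Matrix.transpose_submatrix, Matrix.transpose_one]
      have := Matrix.submatrix_mul (1 : Matrix (Fin (r + 2)) (Fin (r + 2)) F) 1 f id f
        Function.bijective_id
      rw [← this, Matrix.one_mul, Matrix.submatrix_one f hf]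
    let Φ : E → Matrix (Fin (r + 2)) (Fin (r + 2)) F := fun x =>
      P * Algebra.leftMulMatrix b x * P.transpose
    have hΦmul : ∀ x y, Φ x * Φ y = Φ (x * y) := by
      intro x y
      simp only [Φ, map_mul]
      calc P * Algebra.leftMulMatrix b x * P.transpose * (P * Algebra.leftMulMatrix b y * P.transpose)
          = P * Algebra.leftMulMatrix b x * (P.transpose * P) * Algebra.leftMulMatrix b y * P.transpose := by
            simp only [Matrix.mul_assoc]
        _ = _ := by rw [hPP, Matrix.mul_one]; simp only [Matrix.mul_assoc]
    have hΦsub : ∀ x y, Φ x - Φ y = Φ (x - y) := by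
      intro x y
      simp only [Φ, map_sub, Matrix.mul_sub, Matrix.sub_mul]
    have hΦpow : ∀ x m, Φ x ^ (m + 1) = Φ (x ^ (m + 1)) := by
      intro x m
      induction m with
      | zero => simp
      | succ m ih => rw [pow_succ, ih, hΦmul, ← pow_succ]
    have hΦtr : ∀ x, Matrix.trace (Φ x) = Algebra.trace F E x := by
      intro x
      rw [Algebra.trace_eq_matrix_trace b, Matrix.trace_mul_comm, ← Matrix.mul_assoc, hPP,
        Matrix.one_mul]
    have hg : α - α ^ ((p ^ j) ^ 2) ≠ 0 := sub_ne_zero.2 hα.symm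
    have hΦW : ∀ β, Φ β ∈ WW κ (⊤ : Ideal _) (p ^ j) := by
      intro β
      have h1 := WW_mul_g (κ := κ) (B := ⊤) hF (a := Φ (β / (α - α ^ ((p ^ j) ^ 2)))) (c := Φ α)
        trivial trivial (by rw [Commute, SemiconjBy, hΦmul, hΦmul, mul_comm])
      obtain ⟨m, hm⟩ : ∃ m, (p ^ j) ^ 2 = m + 1 :=
        ⟨(p ^ j) ^ 2 - 1, by have : 0 < (p ^ j) ^ 2 := by positivity
                             omega⟩
      rw [hm] at h1 hg
      rw [hΦpow, hΦsub, hΦmul, div_mul_cancel₀ _ hg] at h1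
      exact h1
    intro s
    obtain ⟨β, hβ⟩ := Algebra.trace_surjective F E s
    have := Submodule.sub_mem _ (hΦW β) (mat_sub_trace (κ := κ) hF (Φ β))
    rw [hΦtr, hβ] at this
    simpa using this

end PartMat

section PartFinal
universe u

theorem Crit.false {κ : Type*} {R : Type u} [Field κ] [Ring R] [Algebra κ R]
    {B : Ideal R} {p j : ℕ} (hp : p.Prime) [CharP κ p] (hj : 1 ≤ j) {a b c : R} (ha : a ∈ B)
    (h : Crit κ B (p ^ j) (b * (a - a ^ ((p ^ j) ^ 2)) * c)) : False := by
  have := h.two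
  have hQ2 : (p ^ j) ^ 2 ≠ 0 := pow_ne_zero _ (pow_ne_zero _ hp.ne_zero)
  have hv : b * (a - a ^ ((p ^ j) ^ 2)) * c ∈ B :=
    B.mul_mem_right _ (B.mul_mem_left _ (B.sub_mem ha (Ideal.pow_mem_of_mem _ ha _
      (Nat.pos_of_ne_zero hQ2))))
  have hs := h.isSimpleRing hv
  have hB := h.B_top hv
  have hfin := h.finite hv
  obtain ⟨r, hr, D, iD, iA, ⟨e⟩⟩ := IsSimpleRing.exists_algEquiv_matrix_divisionRing κ R
  have hfM : Finite (Matrix (Fin r) (Fin r) D) := Finite.of_equiv R e.toEquiv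
  have hfD : Finite D := by
    refine Finite.of_injective (fun d : D => (Matrix.single 0 0 d : Matrix (Fin r) (Fin r) D)) ?_
    intro d d' hd
    have := congrFun (congrFun hd 0) 0
    simpa using this
  have hcD : CharP D p := charP_of_injective_algebraMap (algebraMap κ D).injective p
  have hr0 : r ≠ 0 := hr.ne
  obtain rfl | ⟨r', rfl⟩ : r = 1 ∨ ∃ r', r = r' + 2 := by
    rcases r with _ | _ | r
    · exact absurd rfl hr0
    · exact Or.inl rfl
    · exact Or.inr ⟨r, rfl⟩
  · have hcomm : ∀ s t : R, s * t = t * s := by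
      intro s t
      apply e.injective
      rw [map_mul, map_mul]
      ext i j
      rw [Matrix.mul_apply, Matrix.mul_apply]
      simp only [Finset.univ_unique, Finset.sum_singleton, Subsingleton.elim i default,
        Subsingleton.elim j default]
      exact mul_comm _ _
    have h1 := h.central ha (hcomm a)
    apply h.notMem
    rw [h1, sub_self, mul_zero, zero_mul]
    exact Submodule.zero_mem _
  · apply h.notMem
    have h1 := mat_mem (κ := κ) hp hj (e (b * (a - a ^ ((p ^ j) ^ 2)) * c))
    have h2 := WW_map (e.symm : _ →ₐ[κ] R) (B' := B) (fun y _ => by rw [hB]; trivial) h1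
    simpa using h2

theorem main_WW {κ : Type*} {R : Type u} [Field κ] [Ring R] [Algebra κ R]
    {B : Ideal R} (hB : B.IsTwoSided) {p j : ℕ} (hp : p.Prime) [CharP κ p] (hj : 1 ≤ j)
    {a b c : R} (ha : a ∈ B) :
    b * (a - a ^ ((p ^ j) ^ 2)) * c ∈ WW κ B (p ^ j) := by
  by_contra hnot
  set v := b * (a - a ^ ((p ^ j) ^ 2)) * c with hv
  let S : Set (Ideal R) := {K | K.IsTwoSided ∧ ∀ w ∈ WW κ B (p ^ j), v - w ∉ K}
  have hbot : (⊥ : Ideal R) ∈ S := by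
    refine ⟨inferInstance, fun w hw h => hnot ?_⟩
    have : v = w := sub_eq_zero.1 (by simpa using h)
    rw [this]; exact hw
  obtain ⟨K, -, hK⟩ := zorn_le_nonempty₀ S (by
    intro C hCS hC K0 hK0
    have hne : C.Nonempty := ⟨K0, hK0⟩
    refine ⟨sSup C, ⟨⟨fun {x} y hx => ?_⟩, fun w hw h => ?_⟩, fun z hz => le_sSup hz⟩
    · rw [Submodule.mem_sSup_of_directed hne hC.directedOn] at hx ⊢
      obtain ⟨K', hK', hx'⟩ := hx
      have := (hCS hK').1
      exact ⟨K', hK', Ideal.mul_mem_right _ K' hx'⟩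
    · rw [Submodule.mem_sSup_of_directed hne hC.directedOn] at h
      obtain ⟨K', hK', hx'⟩ := h
      exact (hCS hK').2 w hw hx') ⊥ hbot
  have hK2 : K.IsTwoSided := hK.prop.1
  let π : R →ₐ[κ] R ⧸ K := Ideal.Quotient.mkₐ κ K
  have hπ : Function.Surjective π := Ideal.Quotient.mkₐ_surjective κ K
  let B' : Ideal (R ⧸ K) :=
    { carrier := π '' B
      add_mem' := by
        rintro _ _ ⟨x, hx, rfl⟩ ⟨y, hy, rfl⟩
        exact ⟨x + y, B.add_mem hx hy, map_add _ _ _⟩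
      zero_mem' := ⟨0, B.zero_mem, map_zero _⟩
      smul_mem' := by
        rintro r _ ⟨x, hx, rfl⟩
        obtain ⟨r, rfl⟩ := hπ r
        exact ⟨r * x, B.mul_mem_left _ hx, map_mul _ _ _⟩ }
  have hB' : B'.IsTwoSided := ⟨by
    rintro _ r ⟨x, hx, rfl⟩
    obtain ⟨r, rfl⟩ := hπ r
    exact ⟨x * r, B.mul_mem_right _ hx, map_mul _ _ _⟩⟩
  have hWW : WW κ B' (p ^ j) ≤ (WW κ B (p ^ j)).map π.toLinearMap := by
    rw [WW, Submodule.span_le]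
    rintro _ ⟨_, ⟨y, hy, rfl⟩, rfl | rfl⟩
    · exact ⟨y + y ^ (p ^ j), WW_one hy, by simp⟩
    · exact ⟨y ^ (p ^ j + 1), WW_two hy, by simp⟩
  have hfrob : FrobProp (R ⧸ K) (p ^ j) := by
    apply frobProp_of_prime hp _ hj
    rw [← map_natCast (algebraMap κ (R ⧸ K)), CharP.cast_eq_zero, map_zero]
  have hker : ∀ z, π z = 0 ↔ z ∈ K := fun z => Ideal.Quotient.eq_zero_iff_mem
  have hcrit : Crit κ B' (p ^ j) (π v) := by
    refine ⟨hB', hfrob, ?_, ?_⟩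
    · intro h
      obtain ⟨w, hw, hwv⟩ := hWW h
      apply hK.prop.2 w hw
      rw [← hker, map_sub, sub_eq_zero]
      exact hwv.symm
    · intro J hJ hJ0
      by_contra! hc
      let J' : Ideal R := J.comap π.toRingHom
      have hJ' : J'.IsTwoSided := ⟨fun {x} y hx => by
        have hx' : π x ∈ J := hx
        change π (x * y) ∈ J
        rw [map_mul]
        exact J.mul_mem_right _ hx'⟩
      have hJS : J' ∈ S := by
        refine ⟨hJ', fun w hw h => ?_⟩
        have h' : π (v - w) ∈ J := h
        rw [map_sub] at h'
        exact hc (π w) (WW_map π (B' := B') (fun y hy => ⟨y, hy, rfl⟩) hw) h'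
      have hle : K ≤ J' := by
        intro z hz
        change π z ∈ J
        rw [(hker z).2 hz]
        exact J.zero_mem
      have hJK := hK.le_of_ge hJS hle
      apply hJ0
      rw [eq_bot_iff]
      intro z hz
      obtain ⟨z, rfl⟩ := hπ z
      have : π z = 0 := (hker z).2 (hJK hz)
      rw [this]; exact Submodule.zero_mem _
  rw [hv, map_mul, map_mul, map_sub, map_pow] at hcrit
  exact Crit.false (B := B') hp hj ⟨a, ha, rfl⟩ hcrit

end PartFinal

/-- For every `n ≥ 1`, `U_{n,X} ⊆ W_{n,X}`. -/
theorem UnF_le_WnF (x : X) (n : ℕ) (hn : 1 ≤ n) : UnF k X x n ≤ WnF k X x n := by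
  obtain ⟨p, hpc⟩ := CharP.exists k
  obtain ⟨⟨i, hi⟩, hp, hcard⟩ := FiniteField.card k p
  simp only [PNat.mk_coe] at hcard
  have hQ : Fintype.card k ^ n = p ^ (i * n) := by rw [hcard, ← pow_mul]
  have hQ2 : Fintype.card k ^ (2 * n) = (p ^ (i * n)) ^ 2 := by
    rw [← hQ, ← pow_mul, mul_comm]
  have hj : 1 ≤ i * n := Nat.mul_pos hi hn
  have hQ0 : p ^ (i * n) ≠ 0 := pow_ne_zero _ hp.ne_zero
  let B : Ideal (FreeAlgebra k X) := RingHom.ker (FreeAlgebra.lift k (fun _ : X => (0 : k)))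
  have hBA : ∀ y, y ∈ B ↔ y ∈ AugF k X := fun y => Iff.rfl
  have hBt : B.IsTwoSided := inferInstance
  have hW : WW k B (p ^ (i * n)) ≤ WnF k X x n := by
    rw [WW, Submodule.span_le]
    rintro _ ⟨y, hy, rfl | rfl⟩
    · apply Submodule.mem_sup_left
      rw [TSpF, Submodule.mem_sInf]
      rintro V ⟨hV, hHV⟩
      have h1 := hV.2 (fun _ => y) (fun _ => hy) _ (hHV rfl)
      rw [map_add, map_pow, FreeAlgebra.lift_ι_apply, hQ] at h1
      exact h1
    · apply Submodule.mem_sup_right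
      rw [TSpF, Submodule.mem_sInf]
      rintro V ⟨hV, hHV⟩
      have h1 := hV.2 (fun _ => y) (fun _ => hy) _ (hHV rfl)
      rw [map_pow, FreeAlgebra.lift_ι_apply, hQ] at h1
      exact h1
  let U : Submodule k (FreeAlgebra k X) :=
    Submodule.span k {z | ∃ b c, ∃ a ∈ B, z = b * (a - a ^ ((p ^ (i * n)) ^ 2)) * c}
  have hUW : U ≤ WW k B (p ^ (i * n)) := by
    apply Submodule.span_le.2
    rintro _ ⟨b, c, a, ha, rfl⟩
    exact main_WW hBt hp hj ha
  have hg : ∀ a ∈ B, a - a ^ ((p ^ (i * n)) ^ 2) ∈ B := fun a ha =>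
    B.sub_mem ha (Ideal.pow_mem_of_mem _ ha _ (Nat.pos_of_ne_zero (pow_ne_zero _ hQ0)))
  have hlift : ∀ g : X → FreeAlgebra k X, (∀ x, g x ∈ AugF k X) →
      ∀ a ∈ B, FreeAlgebra.lift k g a ∈ B := by
    intro g hgA a ha
    have h1 : (FreeAlgebra.lift k (fun _ : X => (0 : k))).comp (FreeAlgebra.lift k g) =
        FreeAlgebra.lift k (fun _ : X => (0 : k)) := by
      ext z
      have hz : FreeAlgebra.lift k (fun _ : X => (0 : k)) (g z) = 0 := hgA z
      simp [hz]
    change FreeAlgebra.lift k (fun _ : X => (0 : k)) (FreeAlgebra.lift k g a) = 0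
    rw [← AlgHom.comp_apply, h1]
    exact ha
  have hU : IsTIdealF k X U := by
    refine ⟨⟨?_, ?_⟩, ?_⟩
    · apply Submodule.span_le.2
      rintro _ ⟨b, c, a, ha, rfl⟩
      exact B.mul_mem_right _ (B.mul_mem_left _ (hg a ha))
    · intro g hgA
      have h1 : U ≤ U.comap (FreeAlgebra.lift k g).toLinearMap := by
        apply Submodule.span_le.2
        rintro _ ⟨b, c, a, ha, rfl⟩
        refine Submodule.subset_span ⟨FreeAlgebra.lift k g b, FreeAlgebra.lift k g c,
          FreeAlgebra.lift k g a, hlift g hgA a ha, ?_⟩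
        simp
      exact fun v hv => h1 hv
    · intro v hv d _
      constructor
      · have h1 : U ≤ U.comap (LinearMap.mulLeft k d) := by
          apply Submodule.span_le.2
          rintro _ ⟨b, c, a, ha, rfl⟩
          refine Submodule.subset_span ⟨d * b, c, a, ha, ?_⟩
          simp [mul_assoc]
        exact h1 hv
      · have h1 : U ≤ U.comap (LinearMap.mulRight k d) := by
          apply Submodule.span_le.2
          rintro _ ⟨b, c, a, ha, rfl⟩
          refine Submodule.subset_span ⟨b, c * d, a, ha, ?_⟩
          simp [mul_assoc]
        exact h1 hv
  refine le_trans (sInf_le ⟨hU, ?_⟩) (hUW.trans hW)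
  rw [Set.singleton_subset_iff]
  refine Submodule.subset_span ⟨1, 1, FreeAlgebra.ι k x, ?_, ?_⟩
  · change FreeAlgebra.lift k (fun _ : X => (0 : k)) (FreeAlgebra.ι k x) = 0
    simp
  · rw [hQ2]
    simp
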